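/- Let n be a positive integer, H = ℚ(ζ_n + ζ_n⁻¹), ℓ an odd prime with q ≡ 1 (mod ℓ) for some prime factor q of n, K_ℓ the degree-ℓ subfield of ℚ(ζ_q + ζ_q⁻¹), K_2 ⊆ H a real quadratic subfield, and K_{2ℓ} = K_2·K_ℓ. Assume the ℓ-class number of H is ℓ^m and the ℓ-class number of K_2 is ℓ^{m-1}. If the ℓ-class number of K_{2ℓ} is ℓ^{m-1}, then the ℓ-rank of ker(t_{K_2→K_{2ℓ}}) equals r_{2,ℓ}, and the ℓ-rank of the class group of K_{2ℓ} equals r_{2,ℓ}, where r_{2,ℓ} is the ℓ-rank of the class group of K_2. -/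

import Mathlib

open NumberField IntermediateField Module
open scoped nonZeroDivisors

noncomputable section

namespace PaperStmt

/-- `ζ_n = exp(2πi/n)`, a primitive `n`-th root of unity (for `n > 0`). -/
def zetaC (n : ℕ) : ℂ := Complex.exp (2 * (Real.pi : ℂ) * Complex.I / n)

/-- The maximal real subfield `ℚ(ζ_n + ζ_n⁻¹)` of the cyclotomic field `ℚ(ζ_n)`. -/
def realCyclo (n : ℕ) : IntermediateField ℚ ℂ := ℚ⟮zetaC n + (zetaC n)⁻¹⟯

lemma isIntegral_of_pow_eq_one {x : ℂ} {k : ℕ} (hk : k ≠ 0) (h : x ^ k = 1) :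
    IsIntegral ℚ x :=
  ⟨Polynomial.X ^ k - Polynomial.C 1, Polynomial.monic_X_pow_sub_C 1 hk, by
    simp [h]⟩

lemma zetaC_pow (n : ℕ) (hn : n ≠ 0) : zetaC n ^ n = 1 := by
  have hn' : (n : ℂ) ≠ 0 := Nat.cast_ne_zero.mpr hn
  rw [zetaC, ← Complex.exp_nat_mul, mul_comm ((n : ℂ)), div_mul_cancel₀ _ hn',
    Complex.exp_two_pi_mul_I]

lemma isIntegral_zetaC_add_inv (n : ℕ) : IsIntegral ℚ (zetaC n + (zetaC n)⁻¹) := by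
  rcases eq_or_ne n 0 with h | h
  · have h1 : zetaC 0 = 1 := by simp [zetaC]
    subst h
    rw [h1, inv_one]
    exact isIntegral_one.add isIntegral_one
  · exact (isIntegral_of_pow_eq_one h (zetaC_pow n h)).add
      (isIntegral_of_pow_eq_one h (by rw [inv_pow, zetaC_pow n h, inv_one]))

instance (n : ℕ) : FiniteDimensional ℚ (realCyclo n) :=
  IntermediateField.adjoin.finiteDimensional (isIntegral_zetaC_add_inv n)

instance (E : IntermediateField ℚ ℂ) [FiniteDimensional ℚ E] : NumberField E := ⟨⟩

/-- The `p`-part (`p`-primary component / `p`-Sylow subgroup) of a commutative group. -/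
def pPart (G : Type*) [CommGroup G] (p : ℕ) (hp : p.Prime) : Subgroup G :=
  haveI : Fact p.Prime := ⟨hp⟩
  CommGroup.primaryComponent G p

/-- The `p`-class number: the order of the `p`-part. -/
def pCard (G : Type*) [CommGroup G] (p : ℕ) (hp : p.Prime) : ℕ :=
  Nat.card (pPart G p hp)

/-- The `p`-rank: `dim_{F_p} (G_p / G_p^p)`, read off as the exponent of `p`
in the order of the elementary abelian group `G_p / G_p^p`. -/
def pRank (G : Type*) [CommGroup G] (p : ℕ) (hp : p.Prime) : ℕ :=
  (Nat.card
    (↥(pPart G p hp) ⧸ (powMonoidHom p : ↥(pPart G p hp) →* ↥(pPart G p hp)).range)).factorization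
    p

/-- `t` is the homomorphism of class groups induced by extension of ideals along `F ⊆ K`:
it sends the class of a nonzero ideal `I` of `𝓞 F` to the class of `I · 𝓞 K`. -/
def IsClassGroupExtHom {F K : IntermediateField ℚ ℂ} [NumberField F] [NumberField K]
    (hFK : F ≤ K) (t : ClassGroup (𝓞 F) →* ClassGroup (𝓞 K)) : Prop :=
  ∀ (I : (Ideal (𝓞 F))⁰) (J : (Ideal (𝓞 K))⁰),
    Ideal.map (RingOfIntegers.mapRingHom (IntermediateField.inclusion hFK))
        (I : Ideal (𝓞 F)) = (J : Ideal (𝓞 K)) →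
    t (ClassGroup.mk0 I) = ClassGroup.mk0 J

/-- The tent function `v ↦ max(0, 1 - |v|)`; its integer translates form a partition of unity. -/
def tent (v : ℝ) : ℝ := max 0 (1 - |v|)

lemma tent_nonneg (v : ℝ) : 0 ≤ tent v := le_max_left _ _

lemma tent_le_one (v : ℝ) : tent v ≤ 1 := max_le zero_le_one (by linarith [abs_nonneg v])

lemma tent_eq_zero {v : ℝ} (hv : 1 ≤ |v|) : tent v = 0 := max_eq_left (by linarith)

lemma abs_tent_sub_tent_le (v w : ℝ) : |tent v - tent w| ≤ |v - w| := by
  refine (abs_max_sub_max_le_max 0 _ 0 _).trans ?_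
  rw [sub_self, abs_zero]
  refine max_le (abs_nonneg _) ?_
  rw [show 1 - |v| - (1 - |w|) = -(|v| - |w|) by ring, abs_neg]
  exact abs_abs_sub_abs_le v w

lemma hasSum_tent_add_intCast (v : ℝ) : HasSum (fun k : ℤ ↦ tent (v + k)) 1 := by
  have h0 := Int.fract_nonneg v
  have h1 := Int.fract_lt_one v
  have hv : ∀ k : ℤ, v + k = Int.fract v + ((k + ⌊v⌋ : ℤ) : ℝ) := fun k ↦ by
    rw [Int.fract]; push_cast; ring
  have hne : -⌊v⌋ ≠ -⌊v⌋ - 1 := by lia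
  have h := hasSum_sum_of_ne_finset_zero (f := fun k : ℤ ↦ tent (v + k))
    (s := {-⌊v⌋, -⌊v⌋ - 1}) (L := SummationFilter.unconditional ℤ) (fun k hk ↦ by
      simp only [Finset.mem_insert, Finset.mem_singleton, not_or] at hk
      apply tent_eq_zero
      rw [hv, le_abs']
      rcases lt_or_ge (k + ⌊v⌋) 0 with h | h
      · left
        have : k + ⌊v⌋ ≤ -2 := by lia
        have : ((k + ⌊v⌋ : ℤ) : ℝ) ≤ -2 := by exact_mod_cast this
        linarith
      · right
        have : 1 ≤ k + ⌊v⌋ := by lia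
        have : (1 : ℝ) ≤ ((k + ⌊v⌋ : ℤ) : ℝ) := by exact_mod_cast this
        linarith)
  rw [Finset.sum_pair hne] at h
  convert! h using 1
  have e1 : tent (v + ((-⌊v⌋ : ℤ) : ℝ)) = 1 - Int.fract v := by
    rw [hv, tent, neg_add_cancel, Int.cast_zero, add_zero, abs_of_nonneg h0]
    exact max_eq_right (by linarith)
  have e2 : tent (v + ((-⌊v⌋ - 1 : ℤ) : ℝ)) = Int.fract v := by
    rw [hv, tent, show -⌊v⌋ - 1 + ⌊v⌋ = -1 by ring]
    push_cast
    rw [abs_of_nonpos (by linarith)]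
    rw [max_eq_right (by linarith)]
    ring
  rw [e1, e2]; ring

/-- The function `(x, y) ↦ (xy)⁻ˢ`, weighted by a cut-off to the cone
`|log x - log y| < |T|` of the positive quadrant. -/
def coneWeight (T s x y : ℝ) : ℝ := tent ((Real.log x - Real.log y) / T) * (x * y) ^ (-s)

lemma coneWeight_nonneg (T s : ℝ) {x y : ℝ} (hx : 0 ≤ x) (hy : 0 ≤ y) :
    0 ≤ coneWeight T s x y :=
  mul_nonneg (tent_nonneg _) (by positivity)

lemma coneWeight_le_one (T : ℝ) {s x y : ℝ} (hs : 0 ≤ s) (h : 1 ≤ x * y) :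
    coneWeight T s x y ≤ 1 :=
  mul_le_one₀ (tent_le_one _) (by positivity)
    (Real.rpow_le_one_of_one_le_of_nonpos h (by linarith))

lemma le_mul_of_coneWeight_ne_zero {T s x y : ℝ} (hT : T ≠ 0) (hx : 0 < x) (hy : 0 < y)
    (h : coneWeight T s x y ≠ 0) :
    x ≤ Real.exp |T| * y ∧ y ≤ Real.exp |T| * x := by
  have h1 : |(Real.log x - Real.log y) / T| < 1 := by
    by_contra! h'
    exact h (by rw [coneWeight, tent_eq_zero h', zero_mul])
  rw [abs_div, div_lt_one (abs_pos.mpr hT), abs_lt] at h1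
  constructor
  · rw [← Real.log_le_log_iff hx (by positivity), Real.log_mul (Real.exp_ne_zero _) hy.ne',
      Real.log_exp]
    linarith
  · rw [← Real.log_le_log_iff hy (by positivity), Real.log_mul (Real.exp_ne_zero _) hx.ne',
      Real.log_exp]
    linarith

lemma abs_log_sub_log_le {x y m : ℝ} (hm : 0 < m) (hx : m ≤ x) (hy : m ≤ y) :
    |Real.log x - Real.log y| ≤ |x - y| / m := by
  wlog h : y ≤ x generalizing x y
  · rw [abs_sub_comm, abs_sub_comm x y]
    exact this hy hx (le_of_not_ge h)
  have hy' : 0 < y := hm.trans_le hy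
  have hx' : 0 < x := hm.trans_le hx
  rw [abs_of_nonneg (sub_nonneg.mpr (Real.log_le_log hy' h)), abs_of_nonneg (sub_nonneg.mpr h),
    ← Real.log_div hx'.ne' hy'.ne']
  calc Real.log (x / y) ≤ x / y - 1 := Real.log_le_sub_one_of_pos (by positivity)
    _ = (x - y) / y := by field_simp
    _ ≤ (x - y) / m := div_le_div_of_nonneg_left (sub_nonneg.mpr h) hm hy

lemma abs_exp_sub_exp_le {x y M : ℝ} (hx : x ≤ M) (hy : y ≤ M) :
    |Real.exp x - Real.exp y| ≤ |x - y| * Real.exp M := by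
  wlog h : y ≤ x generalizing x y
  · rw [abs_sub_comm, abs_sub_comm x y]
    exact this hy hx (le_of_not_ge h)
  rw [abs_of_nonneg (sub_nonneg.mpr (Real.exp_le_exp.mpr h)), abs_of_nonneg (sub_nonneg.mpr h)]
  have h1 : Real.exp x - Real.exp y = Real.exp x * (1 - Real.exp (y - x)) := by
    rw [Real.exp_sub]; field_simp
  rw [h1, mul_comm]
  refine mul_le_mul ?_ (Real.exp_le_exp.mpr hx) (Real.exp_pos _).le (sub_nonneg.mpr h)
  linarith [Real.add_one_le_exp (y - x)]

/-- Lipschitz estimate for `coneWeight` at a point `(a₁, a₂)` of a cone. -/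
lemma abs_coneWeight_sub_le_of_cone {T s h c m a₁ a₂ b₁ b₂ : ℝ} (hT : T ≠ 0)
    (hs : s ∈ Set.Icc (1 : ℝ) 2) (hh : 1 ≤ h) (hc : 1 ≤ c) (hm : 2 * c * h ≤ m)
    (ha₁ : m ≤ c * a₁) (ha₂ : m ≤ c * a₂) (h₁ : |b₁ - a₁| ≤ h) (h₂ : |b₂ - a₂| ≤ h) :
    |coneWeight T s b₁ b₂ - coneWeight T s a₁ a₂| ≤
      (16 * h * c ^ 3 / |T| + 32 * h * c ^ 3) / m ^ 3 := by
  have hc0 : 0 < c := by linarith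
  have hm0 : 0 < m := lt_of_lt_of_le (by positivity) hm
  set μ := m / (2 * c) with hμ
  have hμ1 : 1 ≤ μ := by rw [hμ, le_div_iff₀ (by positivity)]; nlinarith
  have hμh : h ≤ μ := by rw [hμ, le_div_iff₀ (by positivity)]; nlinarith
  have ha₁' : 2 * μ ≤ a₁ := by
    rw [hμ, show 2 * (m / (2 * c)) = m / c by field_simp, div_le_iff₀ hc0]; linarith
  have ha₂' : 2 * μ ≤ a₂ := by
    rw [hμ, show 2 * (m / (2 * c)) = m / c by field_simp, div_le_iff₀ hc0]; linarith
  have hb₁ : μ ≤ b₁ := by linarith [(abs_le.mp h₁).1]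
  have hb₂ : μ ≤ b₂ := by linarith [(abs_le.mp h₂).1]
  have hμ0 : 0 < μ := by linarith
  have l₁ : |Real.log b₁ - Real.log a₁| ≤ h / μ :=
    (abs_log_sub_log_le hμ0 hb₁ (by linarith)).trans (by gcongr)
  have l₂ : |Real.log b₂ - Real.log a₂| ≤ h / μ :=
    (abs_log_sub_log_le hμ0 hb₂ (by linarith)).trans (by gcongr)
  have hpow : ∀ x y : ℝ, μ ≤ x → μ ≤ y →
      (x * y) ^ (-s) = Real.exp (-s * (Real.log x + Real.log y)) ∧
      -s * (Real.log x + Real.log y) ≤ -(2 * Real.log μ) := by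
    intro x y hx hy
    have hx0 : 0 < x := by linarith
    have hy0 : 0 < y := by linarith
    refine ⟨?_, ?_⟩
    · rw [Real.rpow_def_of_pos (by positivity), Real.log_mul hx0.ne' hy0.ne', mul_comm]
    · have := Real.log_nonneg hμ1
      have h1 := Real.log_le_log hμ0 hx
      have h2 := Real.log_le_log hμ0 hy
      nlinarith [hs.1]
  obtain ⟨ea, ea'⟩ := hpow a₁ a₂ (by linarith) (by linarith)
  obtain ⟨eb, eb'⟩ := hpow b₁ b₂ hb₁ hb₂
  have hexp : Real.exp (-(2 * Real.log μ)) = 1 / μ ^ 2 := by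
    rw [Real.exp_neg, two_mul, Real.exp_add, Real.exp_log hμ0, one_div, sq]
  have hA : (a₁ * a₂) ^ (-s) ≤ 1 / μ ^ 2 := by
    rw [ea, ← hexp]; exact Real.exp_le_exp.mpr ea'
  have hA0 : 0 ≤ (a₁ * a₂) ^ (-s) := by rw [ea]; positivity
  have hAB : |(b₁ * b₂) ^ (-s) - (a₁ * a₂) ^ (-s)| ≤ (4 * h / μ) * (1 / μ ^ 2) := by
    rw [ea, eb, ← hexp]
    refine (abs_exp_sub_exp_le eb' ea').trans ?_
    gcongr
    rw [← mul_sub, abs_mul, abs_neg, abs_of_nonneg (by linarith [hs.1])]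
    have : |Real.log b₁ + Real.log b₂ - (Real.log a₁ + Real.log a₂)| ≤ 2 * (h / μ) := by
      rw [show Real.log b₁ + Real.log b₂ - (Real.log a₁ + Real.log a₂) =
        (Real.log b₁ - Real.log a₁) + (Real.log b₂ - Real.log a₂) by ring]
      linarith [abs_add_le (Real.log b₁ - Real.log a₁) (Real.log b₂ - Real.log a₂)]
    calc s * _ ≤ 2 * (2 * (h / μ)) :=
          mul_le_mul hs.2 this (abs_nonneg _) (by norm_num)
      _ = 4 * h / μ := by ring
  have hW : |tent ((Real.log b₁ - Real.log b₂) / T) - tent ((Real.log a₁ - Real.log a₂) / T)| ≤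
      2 * (h / μ) / |T| := by
    refine (abs_tent_sub_tent_le _ _).trans ?_
    rw [← sub_div, abs_div]
    gcongr
    rw [show Real.log b₁ - Real.log b₂ - (Real.log a₁ - Real.log a₂) =
        (Real.log b₁ - Real.log a₁) - (Real.log b₂ - Real.log a₂) by ring]
    linarith [abs_sub (Real.log b₁ - Real.log a₁) (Real.log b₂ - Real.log a₂)]
  rw [coneWeight, coneWeight]
  set wb := tent ((Real.log b₁ - Real.log b₂) / T)
  set wa := tent ((Real.log a₁ - Real.log a₂) / T)
  have hwb : |wb| ≤ 1 := by rw [abs_of_nonneg (tent_nonneg _)]; exact tent_le_one _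
  calc |wb * (b₁ * b₂) ^ (-s) - wa * (a₁ * a₂) ^ (-s)|
      = |wb * ((b₁ * b₂) ^ (-s) - (a₁ * a₂) ^ (-s)) + (wb - wa) * (a₁ * a₂) ^ (-s)| := by
        congr 1; ring
    _ ≤ |wb| * |(b₁ * b₂) ^ (-s) - (a₁ * a₂) ^ (-s)| + |wb - wa| * |(a₁ * a₂) ^ (-s)| := by
        rw [← abs_mul, ← abs_mul]; exact abs_add_le _ _
    _ ≤ 1 * ((4 * h / μ) * (1 / μ ^ 2)) + (2 * (h / μ) / |T|) * (1 / μ ^ 2) := by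
        rw [abs_of_nonneg hA0]; gcongr
    _ = (16 * h * c ^ 3 / |T| + 32 * h * c ^ 3) / m ^ 3 := by
        rw [hμ]; field_simp; ring

/-- Away from the origin, translating by a bounded vector changes `coneWeight` by at most
a constant times the inverse cube of the distance to the origin, uniformly for `s ∈ [1, 2]`. -/
lemma exists_abs_coneWeight_sub_le {T : ℝ} (hT : T ≠ 0) {h : ℝ} (hh : 1 ≤ h) :
    ∃ C R : ℝ, 0 ≤ C ∧ h < R ∧ ∀ s ∈ Set.Icc (1 : ℝ) 2, ∀ a₁ a₂ b₁ b₂ : ℝ,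
      0 < a₁ → 0 < a₂ → 0 < b₁ → 0 < b₂ → |b₁ - a₁| ≤ h → |b₂ - a₂| ≤ h → R ≤ max a₁ a₂ →
      |coneWeight T s b₁ b₂ - coneWeight T s a₁ a₂| ≤ C / (max a₁ a₂) ^ 3 := by
  set c := Real.exp |T| with hc
  have hc1 : 1 ≤ c := Real.one_le_exp (abs_nonneg T)
  have hTpos : 0 < |T| := abs_pos.mpr hT
  set D := 16 * h * c ^ 3 / |T| + 32 * h * c ^ 3 with hD
  have hD0 : 0 ≤ D := by positivity
  refine ⟨8 * D, 4 * c * h, by positivity, by nlinarith, ?_⟩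
  intro s hs a₁ a₂ b₁ b₂ ha₁ ha₂ hb₁ hb₂ h₁ h₂ hR
  have hch : h ≤ c * h := by nlinarith
  have hmpos : 0 < max a₁ a₂ := lt_of_lt_of_le (by positivity) hR
  have cone : ∀ x y : ℝ, 0 < x → 0 < y → coneWeight T s x y ≠ 0 →
      max x y ≤ c * x ∧ max x y ≤ c * y := by
    intro x y hx hy hne
    obtain ⟨h1, h2⟩ := le_mul_of_coneWeight_ne_zero hT hx hy hne
    refine ⟨max_le (by nlinarith) h2, max_le h1 (by nlinarith)⟩
  by_cases ha : coneWeight T s a₁ a₂ = 0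
  · by_cases hb : coneWeight T s b₁ b₂ = 0
    · rw [ha, hb, sub_zero, abs_zero]; positivity
    · obtain ⟨c1, c2⟩ := cone b₁ b₂ hb₁ hb₂ hb
      have hmb : max a₁ a₂ / 2 ≤ max b₁ b₂ := by
        have : max a₁ a₂ ≤ max b₁ b₂ + h := by
          refine max_le ?_ ?_
          · linarith [(abs_le.mp h₁).1, le_max_left b₁ b₂]
          · linarith [(abs_le.mp h₂).1, le_max_right b₁ b₂]
        linarith
      rw [abs_sub_comm]
      refine (abs_coneWeight_sub_le_of_cone hT hs hh hc1 (m := max b₁ b₂) (by linarith) c1 c2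
        (by rwa [abs_sub_comm]) (by rwa [abs_sub_comm])).trans ?_
      calc D / max b₁ b₂ ^ 3 ≤ D / (max a₁ a₂ / 2) ^ 3 := by gcongr
        _ = 8 * D / max a₁ a₂ ^ 3 := by field_simp; ring
  · obtain ⟨c1, c2⟩ := cone a₁ a₂ ha₁ ha₂ ha
    refine (abs_coneWeight_sub_le_of_cone hT hs hh hc1 (m := max a₁ a₂) (by linarith) c1 c2
      h₁ h₂).trans ?_
    gcongr
    linarith

lemma coneWeight_le_rpow {T : ℝ} (hT : T ≠ 0) {s x y : ℝ} (hs : 0 ≤ s) (hx : 0 < x) (hy : 0 < y)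
    (hxy : 1 ≤ x * y) :
    coneWeight T s x y ≤ (4 * Real.exp |T|) ^ s * (1 + max x y) ^ (-(2 * s)) := by
  by_cases h : coneWeight T s x y = 0
  · rw [h]; positivity
  obtain ⟨h1, h2⟩ := le_mul_of_coneWeight_ne_zero hT hx hy h
  set c := Real.exp |T|
  have hc : 1 ≤ c := Real.one_le_exp (abs_nonneg T)
  set m := max x y
  have hm1 : 1 ≤ m := by
    by_contra! hlt
    have hx1 : x < 1 := (le_max_left _ _).trans_lt hlt
    have hy1 : y < 1 := (le_max_right _ _).trans_lt hlt
    nlinarith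
  have key : (1 + m) ^ 2 ≤ 4 * c * (x * y) := by
    have h4 : (1 + m) ^ 2 ≤ 4 * m ^ 2 := by nlinarith
    have : m ^ 2 ≤ c * (x * y) := by
      rcases max_cases x y with ⟨e, _⟩ | ⟨e, _⟩
      · simp only [m, e]; nlinarith
      · simp only [m, e]; nlinarith
    nlinarith
  calc coneWeight T s x y ≤ 1 * (x * y) ^ (-s) := by
        rw [coneWeight]; gcongr; exact tent_le_one _
    _ ≤ ((1 + m) ^ 2 / (4 * c)) ^ (-s) := by
        rw [one_mul]
        refine Real.rpow_le_rpow_of_nonpos (by positivity) ?_ (by linarith)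
        rw [div_le_iff₀ (by positivity)]; linarith
    _ = (4 * c) ^ s * (1 + m) ^ (-(2 * s)) := by
        rw [Real.div_rpow (by positivity) (by positivity),
          Real.rpow_neg (by positivity : 0 ≤ 4 * c), div_inv_eq_mul, ← Real.rpow_natCast,
          ← Real.rpow_mul (by positivity), mul_comm]
        congr 2
        push_cast; ring

section

variable {R : Type*} [CommRing R]

/-- Weighted sums of a function periodic modulo an ideal are determined by the mean value of the
function, up to the variation of the weight under translations. -/
lemma norm_card_mul_tsum_periodic_sub_le (I : Ideal R) [Fintype (R ⧸ I)] (Φ : R → ℂ)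
    (hΦ : ∀ α, ‖Φ α‖ ≤ 1) (hper : ∀ α, ∀ β ∈ I, Φ (α + β) = Φ α) {g : R → ℝ} (hgs : Summable g) :
    ‖Fintype.card (R ⧸ I) * ∑' α : R, Φ α * (g α : ℂ) -
        (∑ κ : R ⧸ I, Φ κ.out) * ((∑' α : R, g α : ℝ) : ℂ)‖ ≤
      ∑ κ : R ⧸ I, ∑' α, |g (α + κ.out) - g α| := by
  have hΦout : ∀ α : R, Φ α = Φ (Ideal.Quotient.mk I α).out := by
    intro α
    have h1 : (Ideal.Quotient.mk I α).out - α ∈ I := by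
      rw [← Ideal.Quotient.eq]; exact Quotient.out_eq _
    rw [← hper α _ h1, add_sub_cancel]
  have hmean : ∀ α : R, ∑ κ : R ⧸ I, Φ (α + κ.out) = ∑ κ : R ⧸ I, Φ κ.out := by
    intro α
    rw [← Equiv.sum_comp (Equiv.addLeft (Ideal.Quotient.mk I α)) fun κ ↦ Φ κ.out]
    refine Finset.sum_congr rfl fun κ _ ↦ ?_
    rw [hΦout, map_add]
    congr 3
    rw [Equiv.coe_addLeft]
    congr 1
    exact Quotient.out_eq κ
  have hbd : ∀ (F : R → ℂ) (k : R → ℝ), (∀ α, ‖F α‖ ≤ 1) → Summable k →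
      Summable fun α ↦ F α * (k α : ℂ) := by
    intro F k hF hk
    refine Summable.of_norm_bounded hk.norm fun α ↦ ?_
    rw [norm_mul, Complex.norm_real]
    exact mul_le_of_le_one_left (norm_nonneg _) (hF α)
  have hshift : ∀ β : R, ∑' α, Φ α * (g α : ℂ) = ∑' α, Φ (α + β) * (g (α + β) : ℂ) :=
    fun β ↦ ((Equiv.addRight β).tsum_eq fun α ↦ Φ α * (g α : ℂ)).symm
  have hgshift : ∀ β : R, Summable fun α ↦ g (α + β) :=
    fun β ↦ (Equiv.addRight β).summable_iff.mpr hgs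
  have e1 : (Fintype.card (R ⧸ I) : ℂ) * ∑' α : R, Φ α * (g α : ℂ) =
      ∑ κ : R ⧸ I, ∑' α, Φ (α + κ.out) * (g (α + κ.out) : ℂ) := by
    rw [Finset.sum_congr rfl fun (κ : R ⧸ I) _ ↦ (hshift κ.out).symm, Finset.sum_const,
      Finset.card_univ, nsmul_eq_mul]
  have e2 : (∑ κ : R ⧸ I, Φ κ.out) * ((∑' α : R, g α : ℝ) : ℂ) =
      ∑ κ : R ⧸ I, ∑' α, Φ (α + κ.out) * (g α : ℂ) := by
    rw [← Summable.tsum_finsetSum fun κ _ ↦ hbd _ _ (fun α ↦ hΦ _) hgs, Complex.ofReal_tsum,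
      ← tsum_mul_left]
    refine tsum_congr fun α ↦ ?_
    rw [← Finset.sum_mul, hmean]
  rw [e1, e2, ← Finset.sum_sub_distrib]
  refine norm_sum_le_of_le _ fun κ _ ↦ ?_
  rw [← Summable.tsum_sub (hbd _ _ (fun α ↦ hΦ _) (hgshift _)) (hbd _ _ (fun α ↦ hΦ _) hgs)]
  have hdiff : Summable fun α ↦ |g (α + κ.out) - g α| := ((hgshift _).sub hgs).abs
  refine (tsum_of_norm_bounded hdiff.hasSum fun α ↦ ?_).trans le_rfl
  rw [← mul_sub, norm_mul, ← Complex.ofReal_sub, Complex.norm_real, Real.norm_eq_abs]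
  exact mul_le_of_le_one_left (abs_nonneg _) (hΦ _)

end

section LatticeSums

variable {K : Type*} [Field K]

/-- The values of `coneWeight` on the ring of integers of a real quadratic field. -/
def intWeight (w₁ w₂ : InfinitePlace K) (T s : ℝ) (α : 𝓞 K) : ℝ :=
  coneWeight T s (w₁ (α : K)) (w₂ (α : K))

lemma intWeight_nonneg {w₁ w₂ : InfinitePlace K} (T s : ℝ) (α : 𝓞 K) : 0 ≤ intWeight w₁ w₂ T s α :=
  coneWeight_nonneg T s (apply_nonneg _ _) (apply_nonneg _ _)

lemma intWeight_zero {w₁ w₂ : InfinitePlace K} (T : ℝ) {s : ℝ} (hs : s ≠ 0) :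
    intWeight w₁ w₂ T s (0 : 𝓞 K) = 0 := by
  simp [intWeight, coneWeight, hs]

lemma infinitePlace_pos (w : InfinitePlace K) {α : 𝓞 K} (hα : α ≠ 0) : 0 < w (α : K) :=
  InfinitePlace.pos_iff.mpr (by simpa using hα)

variable [NumberField K]

open scoped Classical in
lemma norm_mixedEmbedding_eq_max {w₁ w₂ : InfinitePlace K} (hw : ∀ w, w = w₁ ∨ w = w₂) (x : K) :
    ‖mixedEmbedding K x‖ = max (w₁ x) (w₂ x) := by
  rw [mixedEmbedding.norm_eq_sup'_normAtPlace]
  apply le_antisymm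
  · refine Finset.sup'_le _ _ fun w _ ↦ ?_
    rw [mixedEmbedding.normAtPlace_apply]
    rcases hw w with rfl | rfl
    exacts [le_max_left _ _, le_max_right _ _]
  · refine max_le ?_ ?_ <;> rw [← mixedEmbedding.normAtPlace_apply] <;>
      exact Finset.le_sup' (fun w ↦ mixedEmbedding.normAtPlace w (mixedEmbedding K x))
        (Finset.mem_univ _)

open scoped Classical in
lemma summable_one_add_max_rpow {w₁ w₂ : InfinitePlace K} (hw : ∀ w, w = w₁ ∨ w = w₂)
    (hK : finrank ℚ K = 2) {r : ℝ} (hr : 2 < r) :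
    Summable fun α : 𝓞 K ↦ (1 + max (w₁ (α : K)) (w₂ (α : K))) ^ (-r) := by
  let f : 𝓞 K →ₗ[ℤ] mixedEmbedding.mixedSpace K :=
    ((mixedEmbedding K).comp (algebraMap (𝓞 K) K)).toIntAlgHom.toLinearMap
  have hf : Function.Injective f :=
    (mixedEmbedding_injective K).comp RingOfIntegers.coe_injective
  let e : 𝓞 K ≃ₗ[ℤ] mixedEmbedding.integerLattice K := LinearEquiv.ofInjective f hf
  have hrank : finrank ℤ (mixedEmbedding.integerLattice K) = 2 := by
    rw [← e.finrank_eq, RingOfIntegers.rank, hK]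
  have h1 := ZLattice.summable_norm_rpow (mixedEmbedding.integerLattice K) (-r)
    (by rw [hrank]; push_cast; linarith)
  have h2 : Summable fun α : 𝓞 K ↦ (max (w₁ (α : K)) (w₂ (α : K))) ^ (-r) := by
    refine (e.toEquiv.summable_iff.mpr h1).congr fun α ↦ ?_
    rw [← norm_mixedEmbedding_eq_max hw]
    rfl
  refine Summable.of_norm_bounded_eventually h2 ?_
  refine (Set.finite_singleton (0 : 𝓞 K)).subset fun α hα ↦ ?_
  by_contra hne
  apply hα
  have hpos : 0 < w₁ (α : K) := InfinitePlace.pos_iff.mpr (by simpa using hne)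
  have hm : 0 < max (w₁ (α : K)) (w₂ (α : K)) := lt_max_of_lt_left hpos
  rw [Set.mem_ofPred_eq, Real.norm_of_nonneg (by positivity)]
  exact Real.rpow_le_rpow_of_nonpos hm (by linarith) (by linarith)

variable [IsTotallyReal K]

lemma absNorm_span_eq_mul {w₁ w₂ : InfinitePlace K} (hw : ∀ w, w = w₁ ∨ w = w₂) (hne : w₁ ≠ w₂)
    (α : 𝓞 K) : (Ideal.absNorm (Ideal.span {α}) : ℝ) = w₁ (α : K) * w₂ (α : K) := by
  classical
  have hu : (Finset.univ : Finset (InfinitePlace K)) = {w₁, w₂} := by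
    ext w; simpa using hw w
  have := InfinitePlace.prod_eq_abs_norm (α : K)
  rw [hu, Finset.prod_pair hne, IsTotallyReal.mult_eq, IsTotallyReal.mult_eq, pow_one,
    pow_one] at this
  rw [this, Ideal.absNorm_span_singleton, ← Algebra.coe_norm_int, Nat.cast_natAbs]
  push_cast
  rfl

variable {w₁ w₂ : InfinitePlace K}

lemma one_le_mul_infinitePlace (hw : ∀ w, w = w₁ ∨ w = w₂) (hne : w₁ ≠ w₂) {α : 𝓞 K}
    (hα : α ≠ 0) : 1 ≤ w₁ (α : K) * w₂ (α : K) := by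
  rw [← absNorm_span_eq_mul hw hne]
  have : Ideal.absNorm (Ideal.span {α}) ≠ 0 := by
    rw [Ideal.absNorm_span_singleton]; simpa [Algebra.norm_eq_zero_iff] using hα
  exact_mod_cast Nat.one_le_iff_ne_zero.mpr this

lemma intWeight_le_one (hw : ∀ w, w = w₁ ∨ w = w₂) (hne : w₁ ≠ w₂) (T : ℝ) {s : ℝ} (hs : 0 < s)
    (α : 𝓞 K) : intWeight w₁ w₂ T s α ≤ 1 := by
  rcases eq_or_ne α 0 with rfl | hα
  · rw [intWeight_zero T hs.ne']; exact zero_le_one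
  · exact coneWeight_le_one T hs.le (one_le_mul_infinitePlace hw hne hα)

lemma summable_intWeight (hw : ∀ w, w = w₁ ∨ w = w₂) (hne : w₁ ≠ w₂) (hK : finrank ℚ K = 2)
    {T : ℝ} (hT : T ≠ 0) {s : ℝ} (hs : 1 < s) : Summable (intWeight (K := K) w₁ w₂ T s) := by
  refine Summable.of_nonneg_of_le (intWeight_nonneg T s) (fun α ↦ ?_)
    ((summable_one_add_max_rpow hw hK (r := 2 * s) (by linarith)).mul_left
      ((4 * Real.exp |T|) ^ s))
  rcases eq_or_ne α 0 with rfl | hα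
  · rw [intWeight_zero T (by linarith)]; positivity
  · exact coneWeight_le_rpow hT (by linarith) (infinitePlace_pos _ hα) (infinitePlace_pos _ hα)
      (one_le_mul_infinitePlace hw hne hα)

/-- Translating `intWeight` by a fixed integer changes it by an amount whose sum is bounded
uniformly in `s ∈ (1, 2]`. -/
lemma exists_tsum_abs_intWeight_sub_le (hw : ∀ w, w = w₁ ∨ w = w₂) (hne : w₁ ≠ w₂)
    (hK : finrank ℚ K = 2) {T : ℝ} (hT : T ≠ 0) (β : 𝓞 K) :
    ∃ C : ℝ, ∀ s ∈ Set.Ioc (1 : ℝ) 2,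
      ∑' α : 𝓞 K, |intWeight w₁ w₂ T s (α + β) - intWeight w₁ w₂ T s α| ≤ C := by
  obtain ⟨h, hh1, hh₁, hh₂⟩ : ∃ h : ℝ, 1 ≤ h ∧ w₁ (β : K) ≤ h ∧ w₂ (β : K) ≤ h :=
    ⟨max 1 (max (w₁ (β : K)) (w₂ (β : K))), le_max_left _ _,
      le_max_of_le_right (le_max_left _ _), le_max_of_le_right (le_max_right _ _)⟩
  obtain ⟨C, R, hC, hhR, H⟩ := exists_abs_coneWeight_sub_le hT hh1
  have hR0 : 0 < R := by linarith
  set D := 8 * C + (1 + R) ^ 3 with hD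
  have hsum := (summable_one_add_max_rpow hw hK (r := 3) (by norm_num)).mul_left D
  refine ⟨∑' α : 𝓞 K, D * (1 + max (w₁ (α : K)) (w₂ (α : K))) ^ (-(3 : ℝ)), fun s hs ↦ ?_⟩
  have hs0 : 0 < s := by linarith [hs.1]
  have key : ∀ α : 𝓞 K, |intWeight w₁ w₂ T s (α + β) - intWeight w₁ w₂ T s α| ≤
      D * (1 + max (w₁ (α : K)) (w₂ (α : K))) ^ (-(3 : ℝ)) := by
    intro α
    set m := max (w₁ (α : K)) (w₂ (α : K)) with hm
    have hm0 : 0 ≤ m := le_max_of_le_left (apply_nonneg _ _)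
    have e3 : (1 + m) ^ (-(3 : ℝ)) = 1 / (1 + m) ^ 3 := by
      rw [Real.rpow_neg (by positivity), one_div]; norm_cast
    rw [e3, mul_one_div]
    rcases lt_or_ge m R with hlt | hge
    · have h1 : |intWeight w₁ w₂ T s (α + β) - intWeight w₁ w₂ T s α| ≤ 1 := by
        rw [abs_le]
        have a1 := intWeight_nonneg (w₁ := w₁) (w₂ := w₂) T s (α + β)
        have a2 := intWeight_nonneg (w₁ := w₁) (w₂ := w₂) T s α
        have a3 := intWeight_le_one hw hne T hs0 (α + β)
        have a4 := intWeight_le_one hw hne T hs0 α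
        constructor <;> linarith
      refine h1.trans ?_
      rw [le_div_iff₀ (by positivity), one_mul]
      have : (1 + m) ^ 3 ≤ (1 + R) ^ 3 := by gcongr
      linarith
    · have hα : α ≠ 0 := by
        rintro rfl
        simp at hm
        linarith
      have hαβ : α + β ≠ 0 := by
        intro h0
        have : α = -β := eq_neg_of_add_eq_zero_left h0
        have : m ≤ h := by
          rw [hm, this]
          refine max_le ?_ ?_
          · rw [← InfinitePlace.norm_embedding_eq] at hh₁ ⊢; simpa using hh₁
          · rw [← InfinitePlace.norm_embedding_eq] at hh₂ ⊢; simpa using hh₂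
        linarith
      have hdiff : ∀ w : InfinitePlace K, w (β : K) ≤ h →
          |w ((α + β : 𝓞 K) : K) - w (α : K)| ≤ h := by
        intro w hwβ
        push_cast
        rw [← InfinitePlace.norm_embedding_eq, ← InfinitePlace.norm_embedding_eq, map_add]
        refine (abs_norm_sub_norm_le _ _).trans ?_
        rw [add_sub_cancel_left, InfinitePlace.norm_embedding_eq]
        exact hwβ
      refine (H s ⟨hs.1.le, hs.2⟩ _ _ _ _ (infinitePlace_pos _ hα) (infinitePlace_pos _ hα)
        (infinitePlace_pos _ hαβ) (infinitePlace_pos _ hαβ) (hdiff _ hh₁) (hdiff _ hh₂)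
        hge).trans ?_
      rw [← hm]
      have hm1 : 1 ≤ m := by linarith
      rw [div_le_div_iff₀ (by positivity) (by positivity)]
      have h8 : (1 + m) ^ 3 ≤ 8 * m ^ 3 := by
        calc (1 + m) ^ 3 ≤ (2 * m) ^ 3 := by gcongr; linarith
          _ = 8 * m ^ 3 := by ring
      have : 0 ≤ (1 + R) ^ 3 * m ^ 3 := by positivity
      nlinarith
  exact (Summable.of_nonneg_of_le (fun _ ↦ abs_nonneg _) key hsum).tsum_le_tsum key hsum

/-- Weighted sums of a function on `𝓞 K` periodic modulo an ideal are, up to a bounded error,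
determined by the mean value of the function. -/
lemma exists_norm_tsum_periodic_sub_le (hw : ∀ w, w = w₁ ∨ w = w₂) (hne : w₁ ≠ w₂)
    (hK : finrank ℚ K = 2) {T : ℝ} (hT : T ≠ 0) (I : Ideal (𝓞 K)) [Fintype (𝓞 K ⧸ I)]
    (Φ : 𝓞 K → ℂ) (hΦ : ∀ α, ‖Φ α‖ ≤ 1) (hper : ∀ α, ∀ β ∈ I, Φ (α + β) = Φ α) :
    ∃ C : ℝ, ∀ s ∈ Set.Ioc (1 : ℝ) 2,
      ‖Fintype.card (𝓞 K ⧸ I) * ∑' α : 𝓞 K, Φ α * (intWeight w₁ w₂ T s α : ℂ) -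
        (∑ κ : 𝓞 K ⧸ I, Φ κ.out) * ((∑' α : 𝓞 K, intWeight w₁ w₂ T s α : ℝ) : ℂ)‖ ≤ C := by
  choose C hC using fun β : 𝓞 K ↦ exists_tsum_abs_intWeight_sub_le hw hne hK hT β
  exact ⟨∑ κ : 𝓞 K ⧸ I, C κ.out, fun s hs ↦
    (norm_card_mul_tsum_periodic_sub_le I Φ hΦ hper (summable_intWeight hw hne hK hT hs.1)).trans
      (Finset.sum_le_sum fun κ _ ↦ hC κ.out s hs)⟩

end LatticeSums

section UnitSums

variable {K : Type*} [Field K] [NumberField K] [IsTotallyReal K] {w₁ w₂ : InfinitePlace K}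

/-- Summing `intWeight` over the associates of an integer recovers a power of its norm. -/
lemma exists_hasSum_intWeight_units_mul (hw : ∀ w, w = w₁ ∨ w = w₂) (hne : w₁ ≠ w₂) :
    ∃ T M : ℝ, T ≠ 0 ∧ 0 < M ∧ ∀ (s : ℝ) (α : 𝓞 K), α ≠ 0 →
      HasSum (fun v : (𝓞 K)ˣ ↦ intWeight w₁ w₂ T s (v * α))
        (M * (Ideal.absNorm (Ideal.span {α}) : ℝ) ^ (-s)) := by
  classical
  have hcard : Fintype.card (InfinitePlace K) = 2 := by
    have hu : (Finset.univ : Finset (InfinitePlace K)) = {w₁, w₂} := by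
      ext w; simpa using hw w
    rw [← Finset.card_univ, hu, Finset.card_pair hne]
  have hrank : Units.rank K = 1 := by rw [Units.rank, hcard]
  let i₀ : Fin (Units.rank K) := ⟨0, by omega⟩
  have hsub : ∀ i : Fin (Units.rank K), i = i₀ := fun i ↦ Fin.ext (by omega)
  let u : (𝓞 K)ˣ := Units.fundSystem K i₀
  have hmul : ∀ v : (𝓞 K)ˣ, w₁ ((v : 𝓞 K) : K) * w₂ ((v : 𝓞 K) : K) = 1 := fun v ↦ by
    rw [← absNorm_span_eq_mul hw hne, Ideal.span_singleton_eq_top.mpr v.isUnit]; simp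
  have hpos : ∀ (w : InfinitePlace K) (v : (𝓞 K)ˣ), 0 < w ((v : 𝓞 K) : K) :=
    fun w v ↦ infinitePlace_pos w v.ne_zero
  let U : Units.torsion K × ℤ → (𝓞 K)ˣ := fun p ↦ (p.1 : (𝓞 K)ˣ) * u ^ p.2
  have hprod : ∀ e : Fin (Units.rank K) → ℤ,
      ∏ i, Units.fundSystem K i ^ e i = u ^ e i₀ := fun e ↦
    Fintype.prod_eq_single i₀ fun i hi ↦ absurd (hsub i) hi
  have hU : Function.Bijective U := by
    constructor
    · rintro ⟨ζ, k⟩ ⟨ζ', k'⟩ h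
      obtain ⟨y, -, hy⟩ := Units.exist_unique_eq_mul_prod K (U (ζ, k))
      have h1 := hy (ζ, fun _ ↦ k) (by simp only [hprod]; rfl)
      have h2 := hy (ζ', fun _ ↦ k') (by simp only [hprod, h]; rfl)
      have h3 := h1.trans h2.symm
      rw [Prod.ext_iff] at h3 ⊢
      exact ⟨h3.1, congrFun h3.2 i₀⟩
    · intro v
      obtain ⟨y, hy, -⟩ := Units.exist_unique_eq_mul_prod K v
      exact ⟨(y.1, y.2 i₀), by simp only [hprod] at hy; exact hy.symm⟩
  set T := Real.log (w₁ ((u : 𝓞 K) : K)) - Real.log (w₂ ((u : 𝓞 K) : K)) with hTdef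
  have hT : T ≠ 0 := by
    intro h0
    have heq : w₁ ((u : 𝓞 K) : K) = w₂ ((u : 𝓞 K) : K) :=
      Real.log_injOn_pos (hpos _ _) (hpos _ _) (sub_eq_zero.mp h0)
    have h1 : w₁ ((u : 𝓞 K) : K) = 1 := by
      have := hmul u
      rw [← heq] at this
      nlinarith [hpos w₁ u]
    have htor : u ∈ Units.torsion K := by
      rw [Units.mem_torsion]
      intro w
      rcases hw w with rfl | rfl
      exacts [h1, heq ▸ h1]
    have : U (⟨u, htor⟩, 0) = U (1, 1) := by simp [U]
    have := hU.1 this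
    simp at this
  let _ : Fintype (Units.torsion K) := Fintype.ofFinite _
  refine ⟨T, Fintype.card (Units.torsion K), hT, by exact_mod_cast Fintype.card_pos,
    fun s α hα ↦ ?_⟩
  let e : Units.torsion K × ℤ ≃ (𝓞 K)ˣ := Equiv.ofBijective U hU
  rw [← e.hasSum_iff]
  set x := (Real.log (w₁ (α : K)) - Real.log (w₂ (α : K))) / T with hx
  have hval : (fun v : (𝓞 K)ˣ ↦ intWeight w₁ w₂ T s (v * α)) ∘ e = fun p ↦
      (fun _ : Units.torsion K ↦ (1 : ℝ)) p.1 * tent (x + p.2) *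
        (Ideal.absNorm (Ideal.span {α}) : ℝ) ^ (-s) := by
    ext ⟨ζ, k⟩
    have hζ : ∀ w : InfinitePlace K, w (((ζ : (𝓞 K)ˣ) : 𝓞 K) : K) = 1 :=
      (Units.mem_torsion K).mp ζ.2
    have hwU : ∀ w : InfinitePlace K,
        w (((U (ζ, k) : 𝓞 K) * α : 𝓞 K) : K) = w ((u : 𝓞 K) : K) ^ k * w (α : K) := by
      intro w
      have : (((U (ζ, k) : 𝓞 K) * α : 𝓞 K) : K) =
          (((ζ : (𝓞 K)ˣ) : 𝓞 K) : K) * ((u : 𝓞 K) : K) ^ k * (α : K) := by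
        simp [U, Units.coe_zpow]
      rw [this, map_mul, map_mul, hζ, one_mul, map_zpow₀]
    have h1 := hpos w₁ u
    have h2 := hpos w₂ u
    have h3 := infinitePlace_pos w₁ hα
    have h4 := infinitePlace_pos w₂ hα
    have hN : w₁ ((u : 𝓞 K) : K) ^ k * w₁ (α : K) * (w₂ ((u : 𝓞 K) : K) ^ k * w₂ (α : K)) =
        Ideal.absNorm (Ideal.span {α}) := by
      rw [absNorm_span_eq_mul hw hne, mul_mul_mul_comm, ← mul_zpow, hmul, one_zpow, one_mul]
    change intWeight w₁ w₂ T s ((U (ζ, k) : 𝓞 K) * α) = _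
    rw [intWeight, hwU, hwU, coneWeight, hN, Real.log_mul (zpow_pos h1 k).ne' h3.ne',
      Real.log_mul (zpow_pos h2 k).ne' h4.ne', Real.log_zpow, Real.log_zpow, one_mul]
    congr 2
    rw [hx]
    field_simp
    rw [hTdef]
    ring
  rw [hval]
  refine HasSum.mul_right _ ?_
  have h1 : HasSum (fun _ : Units.torsion K ↦ (1 : ℝ)) (Fintype.card (Units.torsion K)) := by
    simpa using hasSum_fintype fun _ : Units.torsion K ↦ (1 : ℝ)
  have h2 := hasSum_tent_add_intCast x
  have h3 := h1.mul h2 (h1.summable.mul_of_nonneg h2.summable (fun _ ↦ zero_le_one)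
    fun _ ↦ tent_nonneg _)
  simpa using h3

end UnitSums

section ClassSums

variable {K : Type*} [Field K] [NumberField K]

/-- The nonzero elements of an ideal `J` are obtained, uniquely up to units, as generators of
`𝔞 * J` where `𝔞` runs over the integral ideals in the inverse of the class of `J`. -/
lemma exists_generator_parametrization (J : (Ideal (𝓞 K))⁰) :
    ∃ γ : {𝔞 : (Ideal (𝓞 K))⁰ // ClassGroup.mk0 𝔞 = (ClassGroup.mk0 J)⁻¹} → 𝓞 K,
      (∀ 𝔞, γ 𝔞 ≠ 0) ∧
      (∀ 𝔞, Ideal.span {γ 𝔞} = ((𝔞 : (Ideal (𝓞 K))⁰) : Ideal (𝓞 K)) * (J : Ideal (𝓞 K))) ∧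
      Function.Injective (fun p : {𝔞 : (Ideal (𝓞 K))⁰ // ClassGroup.mk0 𝔞 = (ClassGroup.mk0 J)⁻¹} ×
        (𝓞 K)ˣ ↦ (p.2 : 𝓞 K) * γ p.1) ∧
      ∀ α ∈ (J : Ideal (𝓞 K)), α ≠ 0 → ∃ 𝔞, ∃ v : (𝓞 K)ˣ, (v : 𝓞 K) * γ 𝔞 = α := by
  have hex : ∀ 𝔞 : {𝔞 : (Ideal (𝓞 K))⁰ // ClassGroup.mk0 𝔞 = (ClassGroup.mk0 J)⁻¹},
      ∃ a : 𝓞 K, a ≠ 0 ∧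
        Ideal.span {a} = ((𝔞 : (Ideal (𝓞 K))⁰) : Ideal (𝓞 K)) * (J : Ideal (𝓞 K)) := by
    rintro ⟨𝔞, h𝔞⟩
    have h1 : ClassGroup.mk0 (𝔞 * J) = 1 := by rw [map_mul, h𝔞, inv_mul_cancel]
    obtain ⟨a, ha⟩ := ((ClassGroup.mk0_eq_one_iff (𝔞 * J).2).mp h1).principal
    have ha' : Ideal.span {a} = (𝔞 : Ideal (𝓞 K)) * (J : Ideal (𝓞 K)) := ha.symm
    refine ⟨a, ?_, ha'⟩
    rintro rfl
    have : ((𝔞 * J : (Ideal (𝓞 K))⁰) : Ideal (𝓞 K)) ≠ 0 := nonZeroDivisors.coe_ne_zero _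
    apply this
    rw [Submonoid.coe_mul, ← ha']
    simp
  choose γ hγ0 hγ using hex
  have hJ0 : (J : Ideal (𝓞 K)) ≠ 0 := nonZeroDivisors.coe_ne_zero _
  refine ⟨γ, hγ0, hγ, ?_, ?_⟩
  · rintro ⟨𝔞, v⟩ ⟨𝔞', v'⟩ h
    simp only at h
    have hspan : ∀ (𝔠 : {𝔞 : (Ideal (𝓞 K))⁰ // ClassGroup.mk0 𝔞 = (ClassGroup.mk0 J)⁻¹})
        (x : (𝓞 K)ˣ), Ideal.span {(x : 𝓞 K) * γ 𝔠} =
          ((𝔠 : (Ideal (𝓞 K))⁰) : Ideal (𝓞 K)) * (J : Ideal (𝓞 K)) := fun 𝔠 x ↦ by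
      rw [mul_comm, Ideal.span_singleton_mul_right_unit x.isUnit, hγ]
    have h1 : ((𝔞 : (Ideal (𝓞 K))⁰) : Ideal (𝓞 K)) = ((𝔞' : (Ideal (𝓞 K))⁰) : Ideal (𝓞 K)) := by
      have := hspan 𝔞 v
      rw [h, hspan] at this
      exact (mul_right_cancel₀ hJ0 this).symm
    have h2 : 𝔞 = 𝔞' := Subtype.ext (Subtype.ext h1)
    subst h2
    exact Prod.ext rfl (Units.ext (mul_right_cancel₀ (hγ0 _) h))
  · intro α hα hα0
    obtain ⟨𝔞, h𝔞⟩ := Ideal.dvd_span_singleton.mpr hα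
    have h𝔞0 : 𝔞 ≠ 0 := by
      rintro rfl
      rw [mul_zero] at h𝔞
      exact hα0 (by simpa using h𝔞)
    have hcl : ClassGroup.mk0 ⟨𝔞, mem_nonZeroDivisors_of_ne_zero h𝔞0⟩ = (ClassGroup.mk0 J)⁻¹ := by
      rw [eq_inv_iff_mul_eq_one, ← map_mul, ClassGroup.mk0_eq_one_iff]
      refine ⟨⟨α, ?_⟩⟩
      change 𝔞 * (J : Ideal (𝓞 K)) = _
      rw [mul_comm, ← h𝔞]
    refine ⟨⟨⟨𝔞, mem_nonZeroDivisors_of_ne_zero h𝔞0⟩, hcl⟩, ?_⟩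
    have : Ideal.span {γ ⟨⟨𝔞, mem_nonZeroDivisors_of_ne_zero h𝔞0⟩, hcl⟩} = Ideal.span {α} := by
      rw [hγ, h𝔞, mul_comm]
    obtain ⟨v, hv⟩ := Ideal.span_singleton_eq_span_singleton.mp this
    exact ⟨v, by rw [mul_comm, hv]⟩

variable [IsTotallyReal K] {w₁ w₂ : InfinitePlace K}

open scoped Classical in
/-- The sum of a completely multiplicative function of the norm over the integral ideals in an ideal
class, as a weighted sum over the elements of an ideal in the inverse class. -/
lemma hasSum_intWeight_of_mem (hw : ∀ w, w = w₁ ∨ w = w₂) (hne : w₁ ≠ w₂)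
    (hK : finrank ℚ K = 2) {T M s : ℝ} (hT : T ≠ 0) (hM : 0 < M) (hs : 1 < s)
    (hTM : ∀ α : 𝓞 K, α ≠ 0 → HasSum (fun v : (𝓞 K)ˣ ↦ intWeight w₁ w₂ T s (v * α))
        (M * (Ideal.absNorm (Ideal.span {α}) : ℝ) ^ (-s)))
    (J : (Ideal (𝓞 K))⁰) (θ : ℕ →* ℂ) (hθ : ∀ k, ‖θ k‖ ≤ 1) :
    Summable (fun 𝔞 : {𝔞 : (Ideal (𝓞 K))⁰ // ClassGroup.mk0 𝔞 = (ClassGroup.mk0 J)⁻¹} ↦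
      (Ideal.absNorm ((𝔞 : (Ideal (𝓞 K))⁰) : Ideal (𝓞 K)) : ℝ) ^ (-s)) ∧
    ∑' α : 𝓞 K, (if α ∈ (J : Ideal (𝓞 K)) then θ (Ideal.absNorm (Ideal.span {α})) else 0) *
        (intWeight w₁ w₂ T s α : ℂ) =
      θ (Ideal.absNorm (J : Ideal (𝓞 K))) *
        (((Ideal.absNorm (J : Ideal (𝓞 K)) : ℝ) ^ (-s) * M : ℝ) : ℂ) *
        ∑' 𝔞 : {𝔞 : (Ideal (𝓞 K))⁰ // ClassGroup.mk0 𝔞 = (ClassGroup.mk0 J)⁻¹},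
          θ (Ideal.absNorm ((𝔞 : (Ideal (𝓞 K))⁰) : Ideal (𝓞 K))) *
          (((Ideal.absNorm ((𝔞 : (Ideal (𝓞 K))⁰) : Ideal (𝓞 K)) : ℝ) ^ (-s) : ℝ) : ℂ) := by
  obtain ⟨γ, hγ0, hγ, hinj, hsurj⟩ := exists_generator_parametrization J
  set g := intWeight (K := K) w₁ w₂ T s with hg
  have hgs : Summable g := summable_intWeight hw hne hK hT hs
  set b : ℝ := ((Ideal.absNorm (J : Ideal (𝓞 K)) : ℕ) : ℝ) with hb
  have hb0 : 0 < b := by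
    rw [hb]; exact_mod_cast Ideal.absNorm_pos_of_nonZeroDivisors J
  have hNγ : ∀ 𝔞, Ideal.absNorm (Ideal.span {γ 𝔞}) =
      Ideal.absNorm ((𝔞 : (Ideal (𝓞 K))⁰) : Ideal (𝓞 K)) * Ideal.absNorm (J : Ideal (𝓞 K)) :=
    fun 𝔞 ↦ by rw [hγ, map_mul]
  have hNγv : ∀ 𝔞 (v : (𝓞 K)ˣ), Ideal.absNorm (Ideal.span {(v : 𝓞 K) * γ 𝔞}) =
      Ideal.absNorm ((𝔞 : (Ideal (𝓞 K))⁰) : Ideal (𝓞 K)) * Ideal.absNorm (J : Ideal (𝓞 K)) :=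
    fun 𝔞 v ↦ by rw [mul_comm, Ideal.span_singleton_mul_right_unit v.isUnit, hNγ]
  have hpow : ∀ 𝔞 : {𝔞 : (Ideal (𝓞 K))⁰ // ClassGroup.mk0 𝔞 = (ClassGroup.mk0 J)⁻¹},
      M * (Ideal.absNorm (Ideal.span {γ 𝔞}) : ℝ) ^ (-s) = b ^ (-s) * M *
        (Ideal.absNorm ((𝔞 : (Ideal (𝓞 K))⁰) : Ideal (𝓞 K)) : ℝ) ^ (-s) := fun 𝔞 ↦ by
    rw [hNγ]
    push_cast
    rw [Real.mul_rpow (Nat.cast_nonneg _) (Nat.cast_nonneg _)]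
    ring
  have hsum1 : Summable fun p : {𝔞 : (Ideal (𝓞 K))⁰ //
      ClassGroup.mk0 𝔞 = (ClassGroup.mk0 J)⁻¹} × (𝓞 K)ˣ ↦ g ((p.2 : 𝓞 K) * γ p.1) :=
    hgs.comp_injective hinj
  refine ⟨?_, ?_⟩
  · have h1 := hsum1.prod
    have h2 : (fun 𝔞 ↦ ∑' v : (𝓞 K)ˣ, g ((v : 𝓞 K) * γ 𝔞)) = fun 𝔞 :
        {𝔞 : (Ideal (𝓞 K))⁰ // ClassGroup.mk0 𝔞 = (ClassGroup.mk0 J)⁻¹} ↦ b ^ (-s) * M *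
        (Ideal.absNorm ((𝔞 : (Ideal (𝓞 K))⁰) : Ideal (𝓞 K)) : ℝ) ^ (-s) := by
      ext 𝔞
      rw [(hTM _ (hγ0 𝔞)).tsum_eq, hpow]
    simp only at h1
    rw [h2] at h1
    exact (summable_mul_left_iff (by positivity)).mp h1
  · set Ψ : 𝓞 K → ℂ := fun α ↦
      (if α ∈ (J : Ideal (𝓞 K)) then θ (Ideal.absNorm (Ideal.span {α})) else 0) * (g α : ℂ)
      with hΨ
    have hsupp : Function.support Ψ ⊆ Set.range (fun p : {𝔞 : (Ideal (𝓞 K))⁰ //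
        ClassGroup.mk0 𝔞 = (ClassGroup.mk0 J)⁻¹} × (𝓞 K)ˣ ↦ (p.2 : 𝓞 K) * γ p.1) := by
      intro α hα
      have h1 : α ∈ (J : Ideal (𝓞 K)) := by
        by_contra h
        exact hα (by simp [hΨ, h])
      have h2 : α ≠ 0 := by
        rintro rfl
        exact hα (by simp [hΨ, hg, intWeight_zero T (by linarith : s ≠ 0)])
      obtain ⟨𝔞, v, h⟩ := hsurj α h1 h2
      exact ⟨(𝔞, v), h⟩
    rw [← hinj.tsum_eq hsupp]
    have hval : ∀ p : {𝔞 : (Ideal (𝓞 K))⁰ //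
        ClassGroup.mk0 𝔞 = (ClassGroup.mk0 J)⁻¹} × (𝓞 K)ˣ, Ψ ((p.2 : 𝓞 K) * γ p.1) =
        θ (Ideal.absNorm ((p.1 : (Ideal (𝓞 K))⁰) : Ideal (𝓞 K))) *
          θ (Ideal.absNorm (J : Ideal (𝓞 K))) * (g ((p.2 : 𝓞 K) * γ p.1) : ℂ) := by
      rintro ⟨𝔞, v⟩
      have hmem : (v : 𝓞 K) * γ 𝔞 ∈ (J : Ideal (𝓞 K)) := by
        refine Ideal.mul_mem_left _ _ ?_
        rw [← Ideal.dvd_span_singleton, hγ]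
        exact dvd_mul_left _ _
      simp only [hΨ, if_pos hmem, hNγv, map_mul]
    rw [tsum_congr hval]
    have hsum2 : Summable fun p : {𝔞 : (Ideal (𝓞 K))⁰ //
        ClassGroup.mk0 𝔞 = (ClassGroup.mk0 J)⁻¹} × (𝓞 K)ˣ ↦
        θ (Ideal.absNorm ((p.1 : (Ideal (𝓞 K))⁰) : Ideal (𝓞 K))) *
          θ (Ideal.absNorm (J : Ideal (𝓞 K))) * (g ((p.2 : 𝓞 K) * γ p.1) : ℂ) := by
      refine Summable.of_norm_bounded hsum1 fun p ↦ ?_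
      rw [norm_mul, norm_mul, Complex.norm_real,
        Real.norm_of_nonneg (intWeight_nonneg T s _)]
      exact mul_le_of_le_one_left (intWeight_nonneg T s _)
        (mul_le_one₀ (hθ _) (norm_nonneg _) (hθ _))
    rw [hsum2.tsum_prod, ← tsum_mul_left]
    refine tsum_congr fun 𝔞 ↦ ?_
    simp only
    rw [tsum_mul_left, ← Complex.ofReal_tsum, (hTM _ (hγ0 𝔞)).tsum_eq, hpow]
    push_cast
    ring

end ClassSums

section

variable {R : Type*} [CommRing R]

lemma sum_out_eq_zero_of_map_mul (I : Ideal R) [Fintype (R ⧸ I)] (Φ : R → ℂ)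
    (hper : ∀ α, ∀ β ∈ I, Φ (α + β) = Φ α) {a x : R} (hax : a * x - 1 ∈ I) {z : ℂ} (hz : z ≠ 1)
    (h : ∀ α, Φ (a * α) = z * Φ α) : ∑ κ : R ⧸ I, Φ κ.out = 0 := by
  have hout : ∀ α : R, Φ (Ideal.Quotient.mk I α).out = Φ α := by
    intro α
    have h1 : (Ideal.Quotient.mk I α).out - α ∈ I := by
      rw [← Ideal.Quotient.eq]; exact Quotient.out_eq _
    rw [← hper α _ h1, add_sub_cancel]
  have hax' : Ideal.Quotient.mk I a * Ideal.Quotient.mk I x = 1 := by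
    rw [← map_mul, ← map_one (Ideal.Quotient.mk I), Ideal.Quotient.eq]
    exact hax
  let u : (R ⧸ I)ˣ := ⟨Ideal.Quotient.mk I a, Ideal.Quotient.mk I x, hax', by rw [mul_comm, hax']⟩
  have h1 : ∑ κ : R ⧸ I, Φ κ.out = z * ∑ κ : R ⧸ I, Φ κ.out := by
    rw [Finset.mul_sum, ← Equiv.sum_comp (Units.mulLeft u) fun κ ↦ Φ κ.out]
    refine Finset.sum_congr rfl fun κ _ ↦ ?_
    rw [← h, ← hout (a * κ.out), map_mul]
    congr 2
    exact congrArg (Ideal.Quotient.mk I a * ·) (Quotient.out_eq κ).symm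
  have h2 : (1 - z) * ∑ κ : R ⧸ I, Φ κ.out = 0 := by linear_combination h1
  exact (mul_eq_zero.mp h2).resolve_left (sub_ne_zero.mpr hz.symm)

end

section CharacterSums

variable {K : Type*} [Field K] [NumberField K]

lemma norm_add_natCast_mul (q : ℕ) (α β : 𝓞 K) :
    ((Algebra.norm ℤ (α + q * β) : ℤ) : ZMod q) = ((Algebra.norm ℤ α : ℤ) : ZMod q) := by
  classical
  let b := RingOfIntegers.basis K
  have h : ∀ x : 𝓞 K, ((Algebra.norm ℤ x : ℤ) : ZMod q) =
      ((Int.castRingHom (ZMod q)).mapMatrix (Algebra.leftMulMatrix b x)).det := fun x ↦ by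
    rw [Algebra.norm_eq_matrix_det b, ← RingHom.map_det]
    rfl
  rw [h, h, map_add, map_mul, map_natCast, map_add, map_mul, map_natCast]
  congr 1
  ext i j
  simp

/-- Every ideal class contains an integral ideal of norm prime to a given prime. -/
lemma exists_mk0_eq_coprime_absNorm {q : ℕ} (hq : q.Prime) (c : ClassGroup (𝓞 K)) :
    ∃ J : (Ideal (𝓞 K))⁰, ClassGroup.mk0 J = c ∧
      Nat.Coprime q (Ideal.absNorm (J : Ideal (𝓞 K))) := by
  obtain ⟨A, hA⟩ := ClassGroup.mk0_surjective c⁻¹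
  have hA0 : (A : Ideal (𝓞 K)) ≠ 0 := nonZeroDivisors.coe_ne_zero _
  have hq0 : Ideal.span {(q : 𝓞 K)} ≠ 0 := by
    simpa using hq.ne_zero
  have hNq : Ideal.absNorm (Ideal.span {(q : 𝓞 K)}) ≠ 1 := by
    rw [Ideal.absNorm_span_natCast]
    refine (Nat.one_lt_pow ?_ hq.one_lt).ne'
    rw [RingOfIntegers.rank]
    exact Module.finrank_pos.ne'
  obtain ⟨a, ha⟩ := IsDedekindDomain.exists_sup_span_eq
    (Ideal.mul_le_left : (A : Ideal (𝓞 K)) * Ideal.span {(q : 𝓞 K)} ≤ A) (mul_ne_zero hA0 hq0)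
  have ha0 : a ≠ 0 := by
    rintro rfl
    apply hNq
    rw [Ideal.absNorm_eq_one_iff]
    have : (A : Ideal (𝓞 K)) * Ideal.span {(q : 𝓞 K)} = A * ⊤ := by simpa using ha
    exact mul_left_cancel₀ hA0 this
  have haA : a ∈ (A : Ideal (𝓞 K)) := by
    rw [← ha]; exact Ideal.mem_sup_right (Ideal.mem_span_singleton_self a)
  obtain ⟨B, hB⟩ := Ideal.dvd_span_singleton.mpr haA
  have hB0 : B ≠ 0 := by
    rintro rfl
    rw [mul_zero] at hB
    exact ha0 (by simpa using hB)
  refine ⟨⟨B, mem_nonZeroDivisors_of_ne_zero hB0⟩, ?_, ?_⟩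
  · rw [← inv_inj, ← hA, inv_eq_iff_mul_eq_one, ← map_mul, ClassGroup.mk0_eq_one_iff]
    refine ⟨⟨a, ?_⟩⟩
    change B * (A : Ideal (𝓞 K)) = _
    rw [mul_comm, ← hB]
  · have hsup : Ideal.span {(q : 𝓞 K)} ⊔ B = ⊤ := by
      have : (A : Ideal (𝓞 K)) * (Ideal.span {(q : 𝓞 K)} ⊔ B) = A * ⊤ := by
        rw [Ideal.mul_sup, ← hB, ha, Ideal.mul_top]
      exact mul_left_cancel₀ hA0 this
    obtain ⟨x, hx, y, hy, hxy⟩ := Submodule.mem_sup.mp (hsup ▸ Submodule.mem_top : (1 : 𝓞 K) ∈ _)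
    obtain ⟨z, rfl⟩ := Ideal.mem_span_singleton.mp hx
    rw [Nat.Prime.coprime_iff_not_dvd hq]
    intro hdvd
    have h1 : ((Ideal.absNorm B : ℕ) : ℤ) ∣ Algebra.norm ℤ y := Ideal.absNorm_dvd_norm_of_mem hy
    have h2 : ((Algebra.norm ℤ y : ℤ) : ZMod q) = 0 := by
      rw [ZMod.intCast_zmod_eq_zero_iff_dvd _ _]
      exact (Int.natCast_dvd_natCast.mpr hdvd).trans h1
    have h3 := norm_add_natCast_mul q y z
    rw [add_comm, hxy, map_one, h2] at h3
    have : Fact (1 < q) := ⟨hq.one_lt⟩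
    simp at h3

lemma map_absNorm_span_of_even {q : ℕ} (ψ : DirichletCharacter ℂ q) (hψ : ψ (-1) = 1) (α : 𝓞 K) :
    ψ (Ideal.absNorm (Ideal.span {α}) : ℕ) = ψ (Algebra.norm ℤ α : ℤ) := by
  rw [Ideal.absNorm_span_singleton]
  rcases Int.natAbs_eq (Algebra.norm ℤ α) with h | h
  · conv_rhs => rw [h, Int.cast_natCast]
  · conv_rhs => rw [h, Int.cast_neg, ← neg_one_mul, map_mul, hψ, one_mul, Int.cast_natCast]

open scoped Classical in
lemma sum_quotient_out_eq_zero (hK : finrank ℚ K = 2) {q : ℕ} (ψ : DirichletCharacter ℂ q)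
    {g : ℕ} (hg : ψ g ^ 2 ≠ 1) (hg0 : g.Coprime q) (J : Ideal (𝓞 K))
    (hqJ : q.Coprime (Ideal.absNorm J)) {I : Ideal (𝓞 K)}
    (hI : I = J * Ideal.span {(q : 𝓞 K)}) [Fintype (𝓞 K ⧸ I)] :
    ∑ κ : 𝓞 K ⧸ I,
      (if κ.out ∈ J then ψ (Algebra.norm ℤ κ.out : ℤ) else 0) = 0 := by
  set b := Ideal.absNorm J with hb
  set Φ : 𝓞 K → ℂ := fun α ↦ if α ∈ J then ψ (Algebra.norm ℤ α : ℤ) else 0 with hΦ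
  have hIJ : I ≤ J := hI ▸ Ideal.mul_le_left
  have hIq : I ≤ Ideal.span {(q : 𝓞 K)} := hI ▸ Ideal.mul_le_right
  have hper : ∀ α, ∀ β ∈ I, Φ (α + β) = Φ α := by
    intro α β hβ
    have h1 : β ∈ J := hIJ hβ
    obtain ⟨z, rfl⟩ := Ideal.mem_span_singleton.mp (hIq hβ)
    simp only [hΦ, J.add_mem_iff_left h1, norm_add_natCast_mul]
  obtain ⟨a, ha1, ha2⟩ := Nat.chineseRemainder hqJ g 1
  have hac : a.Coprime (q * b) := by
    refine Nat.Coprime.mul_right ?_ ?_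
    · rw [Nat.Coprime, ha1.gcd_eq]; exact hg0
    · rw [Nat.Coprime, ha2.gcd_eq]; simp
  have hqbI : ((q * b : ℕ) : 𝓞 K) ∈ I := by
    push_cast
    rw [hI, mul_comm (q : 𝓞 K)]
    exact Ideal.mul_mem_mul (Ideal.absNorm_mem J) (Ideal.mem_span_singleton_self _)
  obtain ⟨x, y, hxy⟩ := Int.isCoprime_iff_gcd_eq_one.mpr
    ((Int.gcd_natCast_natCast a (q * b)).trans hac)
  have hxy' : (a : 𝓞 K) * x = 1 + (-y) * ((q * b : ℕ) : 𝓞 K) := by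
    have := congrArg (fun t : ℤ ↦ (t : 𝓞 K)) hxy
    push_cast at this ⊢
    linear_combination this
  have hax : (a : 𝓞 K) * x - 1 ∈ I := by
    rw [hxy', add_sub_cancel_left]
    exact I.mul_mem_left _ hqbI
  refine sum_out_eq_zero_of_map_mul I Φ hper hax hg fun α ↦ ?_
  have hiff : (a : 𝓞 K) * α ∈ J ↔ α ∈ J := by
    refine ⟨fun h ↦ ?_, fun h ↦ J.mul_mem_left _ h⟩
    have h1 : x * (a * α) - (a * x - 1) * α ∈ J :=
      J.sub_mem (J.mul_mem_left _ h) (J.mul_mem_right _ (hIJ hax))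
    convert h1 using 1
    ring
  have hNa : Algebra.norm ℤ ((a : 𝓞 K)) = (a : ℤ) ^ 2 := by
    have := Algebra.norm_algebraMap_of_basis (RingOfIntegers.basis K) (a : ℤ)
    rw [← Module.finrank_eq_card_basis (RingOfIntegers.basis K), RingOfIntegers.rank, hK] at this
    simpa using this
  have hag : ((a : ℕ) : ZMod q) = g := (ZMod.natCast_eq_natCast_iff _ _ _).mpr ha1
  simp only [hΦ, hiff]
  split_ifs
  · rw [map_mul, hNa]
    push_cast
    rw [hag, map_mul, map_pow]
  · rw [mul_zero]

end CharacterSums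

section ClassLSeries

variable {K : Type*} [Field K] [NumberField K]

/-- The sum of `θ(N𝔞) N𝔞^{-s}` over the nonzero integral ideals in an ideal class. -/
def classSum (c : ClassGroup (𝓞 K)) (θ : ℕ →* ℂ) (s : ℝ) : ℂ :=
  ∑' 𝔞 : {𝔞 : (Ideal (𝓞 K))⁰ // ClassGroup.mk0 𝔞 = c},
    θ (Ideal.absNorm ((𝔞 : (Ideal (𝓞 K))⁰) : Ideal (𝓞 K))) *
      (((Ideal.absNorm ((𝔞 : (Ideal (𝓞 K))⁰) : Ideal (𝓞 K)) : ℝ) ^ (-s) : ℝ) : ℂ)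

/-- The `L`-series of the character `χ · θ ∘ N` on the nonzero integral ideals. -/
def classLSeries (χ : ClassGroup (𝓞 K) →* ℂˣ) (θ : ℕ →* ℂ) (s : ℝ) : ℂ :=
  ∑' 𝔞 : (Ideal (𝓞 K))⁰, (χ (ClassGroup.mk0 𝔞) : ℂ) * θ (Ideal.absNorm (𝔞 : Ideal (𝓞 K))) *
    (((Ideal.absNorm (𝔞 : Ideal (𝓞 K)) : ℝ) ^ (-s) : ℝ) : ℂ)

lemma norm_classGroup_character (χ : ClassGroup (𝓞 K) →* ℂˣ) (c : ClassGroup (𝓞 K)) :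
    ‖(χ c : ℂ)‖ = 1 := by
  refine Complex.norm_eq_one_of_pow_eq_one (n := Fintype.card (ClassGroup (𝓞 K))) ?_
    Fintype.card_ne_zero
  rw [← Units.val_pow_eq_pow_val, ← map_pow, pow_card_eq_one, map_one, Units.val_one]

lemma classLSeries_eq_sum (χ : ClassGroup (𝓞 K) →* ℂˣ) (θ : ℕ →* ℂ) (hθ : ∀ k, ‖θ k‖ ≤ 1) {s : ℝ}
    (hs : Summable fun 𝔞 : (Ideal (𝓞 K))⁰ ↦ (Ideal.absNorm (𝔞 : Ideal (𝓞 K)) : ℝ) ^ (-s)) :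
    classLSeries χ θ s = ∑ c, (χ c : ℂ) * classSum c θ s := by
  have hsum : Summable fun 𝔞 : (Ideal (𝓞 K))⁰ ↦
      (χ (ClassGroup.mk0 𝔞) : ℂ) * θ (Ideal.absNorm (𝔞 : Ideal (𝓞 K))) *
        (((Ideal.absNorm (𝔞 : Ideal (𝓞 K)) : ℝ) ^ (-s) : ℝ) : ℂ) := by
    refine Summable.of_norm_bounded hs fun 𝔞 ↦ ?_
    have h0 : (0 : ℝ) ≤ (Ideal.absNorm (𝔞 : Ideal (𝓞 K)) : ℝ) ^ (-s) := by positivity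
    rw [norm_mul, norm_mul, norm_classGroup_character, one_mul, Complex.norm_real,
      Real.norm_of_nonneg h0]
    exact mul_le_of_le_one_left h0 (hθ _)
  let e := Equiv.sigmaFiberEquiv (ClassGroup.mk0 : (Ideal (𝓞 K))⁰ → ClassGroup (𝓞 K))
  have hsum' := e.summable_iff.mpr hsum
  simp only [Function.comp_def] at hsum'
  rw [classLSeries, ← e.tsum_eq, hsum'.tsum_sigma, tsum_fintype]
  refine Finset.sum_congr rfl fun c _ ↦ ?_
  rw [classSum, ← tsum_mul_left]
  refine tsum_congr fun 𝔞 ↦ ?_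
  obtain ⟨𝔞, rfl⟩ := 𝔞
  rw [mul_assoc]
  rfl

variable [IsTotallyReal K] {w₁ w₂ : InfinitePlace K}

lemma summable_absNorm_rpow (hw : ∀ w, w = w₁ ∨ w = w₂) (hne : w₁ ≠ w₂)
    (hK : finrank ℚ K = 2) {s : ℝ} (hs : 1 < s) :
    Summable fun 𝔞 : (Ideal (𝓞 K))⁰ ↦ (Ideal.absNorm (𝔞 : Ideal (𝓞 K)) : ℝ) ^ (-s) := by
  obtain ⟨T, M, hT, hM, hTM⟩ := exists_hasSum_intWeight_units_mul hw hne
  let e := Equiv.sigmaFiberEquiv (ClassGroup.mk0 : (Ideal (𝓞 K))⁰ → ClassGroup (𝓞 K))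
  rw [← e.summable_iff]
  refine (summable_sigma_of_nonneg fun _ ↦ Real.rpow_nonneg (Nat.cast_nonneg _) _).mpr
    ⟨fun c ↦ ?_, Summable.of_finite⟩
  obtain ⟨J, hJ⟩ := ClassGroup.mk0_surjective c⁻¹
  have := (hasSum_intWeight_of_mem hw hne hK hT hM hs (hTM s) J 1 (by simp)).1
  rw [hJ, inv_inv] at this
  exact this

/-- Class sums twisted by an even Dirichlet character with nontrivial square are bounded. -/
lemma exists_norm_classSum_dirichlet_le (hw : ∀ w, w = w₁ ∨ w = w₂) (hne : w₁ ≠ w₂)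
    (hK : finrank ℚ K = 2) {q : ℕ} (hq : q.Prime) (ψ : DirichletCharacter ℂ q) (hψ : ψ (-1) = 1)
    {g : ℕ} (hg : ψ g ^ 2 ≠ 1) (hgq : g.Coprime q) (θ : ℕ →* ℂ) (hθ : ∀ k : ℕ, θ k = ψ k)
    (c : ClassGroup (𝓞 K)) :
    ∃ C : ℝ, ∀ s ∈ Set.Ioc (1 : ℝ) 2, ‖classSum c θ s‖ ≤ C := by
  classical
  obtain ⟨T, M, hT, hM, hTM⟩ := exists_hasSum_intWeight_units_mul hw hne
  obtain ⟨J, hJc, hJq⟩ := exists_mk0_eq_coprime_absNorm hq c⁻¹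
  obtain ⟨I, hI⟩ : ∃ I, I = (J : Ideal (𝓞 K)) * Ideal.span {(q : 𝓞 K)} := ⟨_, rfl⟩
  have hθ1 : ∀ k, ‖θ k‖ ≤ 1 := fun k ↦ by rw [hθ]; exact ψ.norm_le_one _
  have hJ0 : (J : Ideal (𝓞 K)) ≠ 0 := nonZeroDivisors.coe_ne_zero _
  have hI0 : I ≠ ⊥ := by
    rw [hI]
    exact mul_ne_zero hJ0 (by simpa using hq.ne_zero)
  have _ := Ideal.finiteQuotientOfFreeOfNeBot I hI0
  let _ : Fintype (𝓞 K ⧸ I) := Fintype.ofFinite _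
  have hIJ : I ≤ J := hI ▸ Ideal.mul_le_left
  have hIq : I ≤ Ideal.span {(q : 𝓞 K)} := hI ▸ Ideal.mul_le_right
  set Φ : 𝓞 K → ℂ := fun α ↦ if α ∈ (J : Ideal (𝓞 K)) then ψ (Algebra.norm ℤ α : ℤ) else 0 with hΦ
  have hper : ∀ α, ∀ β ∈ I, Φ (α + β) = Φ α := by
    intro α β hβ
    have h1 : β ∈ (J : Ideal (𝓞 K)) := hIJ hβ
    obtain ⟨z, rfl⟩ := Ideal.mem_span_singleton.mp (hIq hβ)
    simp only [hΦ, (J : Ideal (𝓞 K)).add_mem_iff_left h1, norm_add_natCast_mul]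
  have hΦ1 : ∀ α, ‖Φ α‖ ≤ 1 := by
    intro α
    simp only [hΦ]
    split_ifs
    · exact ψ.norm_le_one _
    · simp
  obtain ⟨C, hC⟩ := exists_norm_tsum_periodic_sub_le hw hne hK hT I Φ hΦ1 hper
  have hzero : ∑ κ : 𝓞 K ⧸ I, Φ κ.out = 0 := sum_quotient_out_eq_zero hK ψ hg hgq J hJq hI
  set b : ℝ := ((Ideal.absNorm (J : Ideal (𝓞 K)) : ℕ) : ℝ) with hb
  have hb1 : 1 ≤ b := by
    rw [hb]; exact_mod_cast Ideal.absNorm_pos_of_nonZeroDivisors J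
  have hθb : ‖θ (Ideal.absNorm (J : Ideal (𝓞 K)))‖ = 1 := by
    have hu := (ZMod.isUnit_iff_coprime _ q).mpr hJq.symm
    rw [hθ, ← hu.unit_spec, DirichletCharacter.unit_norm_eq_one]
  refine ⟨C * (b ^ (2 : ℝ) / M), fun s hs ↦ ?_⟩
  have h1 := hC s hs
  rw [hzero, zero_mul, sub_zero, norm_mul, Complex.norm_natCast] at h1
  have hcard : (1 : ℝ) ≤ Fintype.card (𝓞 K ⧸ I) := by exact_mod_cast Fintype.card_pos
  have h2 := (hasSum_intWeight_of_mem hw hne hK hT hM hs.1 (hTM s) J θ hθ1).2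
  have h3 : ∀ α : 𝓞 K, (if α ∈ (J : Ideal (𝓞 K)) then θ (Ideal.absNorm (Ideal.span {α})) else 0) *
      (intWeight w₁ w₂ T s α : ℂ) = Φ α * (intWeight w₁ w₂ T s α : ℂ) := by
    intro α
    simp only [hΦ, hθ, map_absNorm_span_of_even ψ hψ]
  rw [tsum_congr h3] at h2
  have h4 : ‖∑' α, Φ α * (intWeight w₁ w₂ T s α : ℂ)‖ ≤ C := by
    refine le_trans ?_ h1
    exact le_mul_of_one_le_left (norm_nonneg _) hcard
  rw [h2, norm_mul, norm_mul, hθb, one_mul, Complex.norm_real,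
    Real.norm_of_nonneg (by positivity), hJc, inv_inv] at h4
  change b ^ (-s) * M * ‖classSum c θ s‖ ≤ C at h4
  have h5 : b ^ (-(2 : ℝ)) ≤ b ^ (-s) := Real.rpow_le_rpow_of_exponent_le hb1 (by linarith [hs.2])
  have h6 : b ^ (-(2 : ℝ)) * M * ‖classSum c θ s‖ ≤ C := le_trans (by gcongr) h4
  rw [Real.rpow_neg (by positivity)] at h6
  have hb2 : 0 < b ^ (2 : ℝ) := by positivity
  calc ‖classSum c θ s‖ = ((b ^ (2 : ℝ))⁻¹ * M * ‖classSum c θ s‖) * (b ^ (2 : ℝ) / M) := by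
        field_simp
    _ ≤ C * (b ^ (2 : ℝ) / M) := by gcongr

/-- The class sums without twist have the same asymptotic behaviour for all classes. -/
lemma exists_abs_classSum_one_sub_le (hw : ∀ w, w = w₁ ∨ w = w₂) (hne : w₁ ≠ w₂)
    (hK : finrank ℚ K = 2) :
    ∃ Z : ℝ → ℂ, ∀ c : ClassGroup (𝓞 K), ∃ C : ℝ, ∀ s ∈ Set.Ioc (1 : ℝ) 2,
      ‖classSum c 1 s - Z s‖ ≤ C := by
  classical
  obtain ⟨T, M, hT, hM, hTM⟩ := exists_hasSum_intWeight_units_mul hw hne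
  set Z : ℝ → ℝ := fun s ↦ ∑' α : 𝓞 K, intWeight w₁ w₂ T s α with hZ
  have hZ0 : ∀ s, 0 ≤ Z s := fun s ↦ tsum_nonneg fun α ↦ intWeight_nonneg T s α
  have hJ : ∀ J : (Ideal (𝓞 K))⁰, ∃ C : ℝ, ∀ s ∈ Set.Ioc (1 : ℝ) 2,
      ‖(((Ideal.absNorm (J : Ideal (𝓞 K)) : ℝ) ^ (1 - s) : ℝ) : ℂ) *
        (M * classSum (ClassGroup.mk0 J)⁻¹ 1 s) - (Z s : ℂ)‖ ≤ C := by
    intro J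
    obtain ⟨I, hI⟩ : ∃ I, I = (J : Ideal (𝓞 K)) := ⟨_, rfl⟩
    have hI0 : I ≠ ⊥ := by rw [hI]; exact nonZeroDivisors.coe_ne_zero _
    have _ := Ideal.finiteQuotientOfFreeOfNeBot I hI0
    let _ : Fintype (𝓞 K ⧸ I) := Fintype.ofFinite _
    set Φ : 𝓞 K → ℂ := fun α ↦ if α ∈ I then 1 else 0 with hΦ
    have hper : ∀ α, ∀ β ∈ I, Φ (α + β) = Φ α := by
      intro α β hβ
      simp only [hΦ, I.add_mem_iff_left hβ]
    have hΦ1 : ∀ α, ‖Φ α‖ ≤ 1 := by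
      intro α
      simp only [hΦ]
      split_ifs <;> simp
    obtain ⟨C, hC⟩ := exists_norm_tsum_periodic_sub_le hw hne hK hT I Φ hΦ1 hper
    have hone : ∑ κ : 𝓞 K ⧸ I, Φ κ.out = 1 := by
      have : ∀ κ : 𝓞 K ⧸ I, Φ κ.out = if κ = 0 then 1 else 0 := by
        intro κ
        have : κ.out ∈ I ↔ κ = 0 := by
          rw [← Ideal.Quotient.eq_zero_iff_mem]
          exact ⟨fun h ↦ (Quotient.out_eq κ).symm.trans h, fun h ↦ (Quotient.out_eq κ).trans h⟩
        simp only [hΦ, this]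
      simp [this]
    refine ⟨C, fun s hs ↦ ?_⟩
    have h1 := hC s hs
    rw [hone, one_mul] at h1
    have h2 := (hasSum_intWeight_of_mem hw hne hK hT hM hs.1 (hTM s) J 1 (by simp)).2
    simp only [MonoidHom.one_apply, one_mul, ← hI] at h2
    rw [h2] at h1
    have hcard : Fintype.card (𝓞 K ⧸ I) = Ideal.absNorm (J : Ideal (𝓞 K)) := by
      rw [← hI, Ideal.absNorm_apply, Submodule.cardQuot_apply, Nat.card_eq_fintype_card]
    have hb0 : (0 : ℝ) < Ideal.absNorm (J : Ideal (𝓞 K)) := by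
      exact_mod_cast Ideal.absNorm_pos_of_nonZeroDivisors J
    convert h1 using 3
    rw [hcard, sub_eq_add_neg, Real.rpow_add hb0, Real.rpow_one, ← hI]
    simp only [classSum, MonoidHom.one_apply, one_mul]
    push_cast
    ring
  refine ⟨fun s ↦ Z s / M, fun c ↦ ?_⟩
  obtain ⟨J, hJc⟩ := ClassGroup.mk0_surjective c⁻¹
  set b := Ideal.absNorm (J : Ideal (𝓞 K)) with hb
  have hbpos : 0 < b := Ideal.absNorm_pos_of_nonZeroDivisors J
  have hb1 : (1 : ℝ) ≤ b := by exact_mod_cast hbpos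
  let B : (Ideal (𝓞 K))⁰ := ⟨Ideal.span {(b : 𝓞 K)}, mem_nonZeroDivisors_of_ne_zero (by
    simpa using hbpos.ne')⟩
  have hB : ClassGroup.mk0 B = 1 := (ClassGroup.mk0_eq_one_iff B.2).mpr ⟨⟨_, rfl⟩⟩
  have hNB : Ideal.absNorm (B : Ideal (𝓞 K)) = b ^ 2 := by
    change Ideal.absNorm (Ideal.span {(b : 𝓞 K)}) = _
    rw [Ideal.absNorm_span_natCast, RingOfIntegers.rank, hK]
  obtain ⟨C₁, hC₁⟩ := hJ 1
  obtain ⟨C₂, hC₂⟩ := hJ B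
  obtain ⟨C₃, hC₃⟩ := hJ J
  refine ⟨(b * (C₁ + C₂) + b * C₃) / M, fun s hs ↦ ?_⟩
  have h1 := hC₁ s hs
  have h2 := hC₂ s hs
  have h3 := hC₃ s hs
  rw [hB, inv_one, hNB] at h2
  rw [hJc, inv_inv, ← hb] at h3
  simp only [map_one, OneMemClass.coe_one, Nat.cast_one, Real.one_rpow, Complex.ofReal_one,
    inv_one, one_mul] at h1
  push_cast at h2
  set t := (b : ℝ) ^ (s - 1) with ht
  have hbt : (b : ℝ) ^ (1 - s) = t⁻¹ := by
    rw [ht, ← Real.rpow_neg (Nat.cast_nonneg _)]; congr 1; ring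
  have ht1 : 1 ≤ t := Real.one_le_rpow hb1 (by linarith [hs.1])
  have htb : t ≤ b := by
    calc t ≤ (b : ℝ) ^ (1 : ℝ) := Real.rpow_le_rpow_of_exponent_le hb1 (by linarith [hs.2])
      _ = b := Real.rpow_one _
  have hbt2 : ((b : ℝ) ^ 2) ^ (1 - s) = (t⁻¹) ^ 2 := by
    rw [← hbt, ← Real.rpow_natCast, ← Real.rpow_natCast, ← Real.rpow_mul (Nat.cast_nonneg _),
      ← Real.rpow_mul (Nat.cast_nonneg _), mul_comm]
  rw [hbt2] at h2
  rw [hbt] at h3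
  have hZc : ‖(Z s : ℂ)‖ = Z s := by rw [Complex.norm_real, Real.norm_of_nonneg (hZ0 s)]
  set X := (M : ℂ) * classSum (1 : ClassGroup (𝓞 K)) 1 s with hX
  set Y := (M : ℂ) * classSum c 1 s with hY
  have ht0 : 0 < t := by linarith
  have hti : t⁻¹ ≤ 1 := inv_le_one_of_one_le₀ ht1
  have hti0 : 0 < t⁻¹ := inv_pos.mpr ht0
  have h4 : (1 - t⁻¹ ^ 2) * Z s ≤ C₁ + C₂ := by
    have e1 : (((1 - t⁻¹ ^ 2) * Z s : ℝ) : ℂ) =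
        ((t⁻¹ ^ 2 : ℝ) : ℂ) * (X - Z s) - (((t⁻¹ ^ 2 : ℝ) : ℂ) * X - Z s) := by
      push_cast; ring
    have e2 : ‖(((1 - t⁻¹ ^ 2) * Z s : ℝ) : ℂ)‖ ≤ 1 * C₁ + C₂ := by
      rw [e1]
      refine (norm_sub_le _ _).trans (add_le_add ?_ h2)
      rw [norm_mul, Complex.norm_real, Real.norm_of_nonneg (by positivity)]
      exact mul_le_mul (pow_le_one₀ hti0.le hti) h1 (norm_nonneg _) zero_le_one
    rw [Complex.norm_real, one_mul] at e2
    exact (le_abs_self _).trans e2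
  have h5 : (t - 1) * Z s ≤ b * (C₁ + C₂) := by
    have e1 : (t - 1) * Z s = t * ((1 - t⁻¹) * Z s) := by field_simp
    have e2 : (1 - t⁻¹) * Z s ≤ (1 - t⁻¹ ^ 2) * Z s := by
      refine mul_le_mul_of_nonneg_right ?_ (hZ0 s)
      nlinarith
    rw [e1]
    exact mul_le_mul htb (e2.trans h4) (mul_nonneg (by linarith) (hZ0 s)) (by linarith)
  have h6 : Y - Z s = (t : ℂ) * (((t⁻¹ : ℝ) : ℂ) * Y - Z s) + (((t - 1) * Z s : ℝ) : ℂ) := by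
    have : (t : ℂ) ≠ 0 := by exact_mod_cast ht0.ne'
    push_cast
    field_simp
    ring
  have h7 : ‖Y - Z s‖ ≤ b * (C₁ + C₂) + b * C₃ := by
    rw [h6, add_comm]
    refine (norm_add_le _ _).trans (add_le_add ?_ ?_)
    · rw [Complex.norm_real, Real.norm_of_nonneg (mul_nonneg (by linarith) (hZ0 s))]
      exact h5
    · rw [norm_mul, Complex.norm_real, Real.norm_of_nonneg ht0.le]
      exact mul_le_mul htb h3 (norm_nonneg _) (by linarith)
  have hM0 : (M : ℂ) ≠ 0 := by exact_mod_cast hM.ne'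
  have h8 : classSum c 1 s - Z s / M = (Y - Z s) / M := by
    rw [hY]; field_simp
  rw [h8, norm_div, Complex.norm_real, Real.norm_of_nonneg hM.le]
  gcongr

lemma exists_norm_classLSeries_dirichlet_le (hw : ∀ w, w = w₁ ∨ w = w₂) (hne : w₁ ≠ w₂)
    (hK : finrank ℚ K = 2) {q : ℕ} (hq : q.Prime) (ψ : DirichletCharacter ℂ q) (hψ : ψ (-1) = 1)
    {g : ℕ} (hg : ψ g ^ 2 ≠ 1) (hgq : g.Coprime q) (θ : ℕ →* ℂ) (hθ : ∀ k : ℕ, θ k = ψ k)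
    (χ : ClassGroup (𝓞 K) →* ℂˣ) :
    ∃ C : ℝ, ∀ s ∈ Set.Ioc (1 : ℝ) 2, ‖classLSeries χ θ s‖ ≤ C := by
  choose C hC using exists_norm_classSum_dirichlet_le hw hne hK hq ψ hψ hg hgq θ hθ
  refine ⟨∑ c, C c, fun s hs ↦ ?_⟩
  rw [classLSeries_eq_sum χ θ (fun k ↦ by rw [hθ]; exact ψ.norm_le_one _)
    (summable_absNorm_rpow hw hne hK hs.1)]
  refine norm_sum_le_of_le _ fun c _ ↦ ?_
  rw [norm_mul, norm_classGroup_character, one_mul]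
  exact hC c s hs

lemma exists_norm_classLSeries_one_le (hw : ∀ w, w = w₁ ∨ w = w₂) (hne : w₁ ≠ w₂)
    (hK : finrank ℚ K = 2) {χ : ClassGroup (𝓞 K) →* ℂˣ} (hχ : χ ≠ 1) :
    ∃ C : ℝ, ∀ s ∈ Set.Ioc (1 : ℝ) 2, ‖classLSeries χ 1 s‖ ≤ C := by
  obtain ⟨Z, hZ⟩ := exists_abs_classSum_one_sub_le hw hne hK
  choose C hC using hZ
  refine ⟨∑ c, C c, fun s hs ↦ ?_⟩
  have hχ0 : ∑ c, (χ c : ℂ) = 0 :=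
    sum_hom_units_eq_zero ((Units.coeHom ℂ).comp χ) fun h ↦ hχ (MonoidHom.ext fun c ↦
      Units.ext (DFunLike.congr_fun h c))
  have : classLSeries χ 1 s = ∑ c, (χ c : ℂ) * (classSum c 1 s - Z s) := by
    rw [classLSeries_eq_sum χ 1 (by simp) (summable_absNorm_rpow hw hne hK hs.1)]
    simp only [mul_sub, Finset.sum_sub_distrib, ← Finset.sum_mul, hχ0, zero_mul, sub_zero]
  rw [this]
  refine norm_sum_le_of_le _ fun c _ ↦ ?_
  rw [norm_mul, norm_classGroup_character, one_mul]
  exact hC c s hs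

end ClassLSeries

section EulerProduct

open IsDedekindDomain

variable {R : Type*} [CommRing R] [IsDedekindDomain R]

/-- A height one prime as an element of the monoid of nonzero ideals. -/
def primeIdeal (v : HeightOneSpectrum R) : (Ideal R)⁰ :=
  ⟨v.asIdeal, mem_nonZeroDivisors_of_ne_zero v.ne_bot⟩

/-- The nonzero ideals not divisible by any of the primes in a finite set. -/
def sievedIdeals (S : Finset (HeightOneSpectrum R)) : Set (Ideal R)⁰ :=
  {𝔞 | ∀ v ∈ S, ¬ v.asIdeal ∣ (𝔞 : Ideal R)}

lemma tsum_indicator_sievedIdeals (f : (Ideal R)⁰ →* ℂ) (hf : Summable f)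
    (S : Finset (HeightOneSpectrum R)) :
    ∑' 𝔞, (sievedIdeals S).indicator f 𝔞 = (∑' 𝔞, f 𝔞) * ∏ v ∈ S, (1 - f (primeIdeal v)) := by
  classical
  induction S using Finset.induction_on with
  | empty => simp [sievedIdeals]
  | insert v S hv ih =>
    rw [Finset.prod_insert hv, mul_left_comm, ← ih, sub_mul, one_mul, ← tsum_mul_left]
    have hinj : Function.Injective (fun 𝔟 : (Ideal R)⁰ ↦ primeIdeal v * 𝔟) := fun 𝔟 𝔟' h ↦ by
      have h1 : v.asIdeal * (𝔟 : Ideal R) = v.asIdeal * (𝔟' : Ideal R) := congrArg Subtype.val h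
      exact Subtype.ext (mul_left_cancel₀ v.ne_bot h1)
    set h : (Ideal R)⁰ → ℂ := fun 𝔞 ↦
      if v.asIdeal ∣ (𝔞 : Ideal R) then (sievedIdeals S).indicator f 𝔞 else 0 with hh
    have hsupp : Function.support h ⊆ Set.range (fun 𝔟 : (Ideal R)⁰ ↦ primeIdeal v * 𝔟) := by
      intro 𝔞 h𝔞
      have hdvd : v.asIdeal ∣ (𝔞 : Ideal R) := by
        by_contra hcon
        exact h𝔞 (by simp [hh, hcon])
      obtain ⟨𝔟, h𝔟⟩ := hdvd
      have h𝔟0 : 𝔟 ≠ 0 := by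
        rintro rfl
        exact nonZeroDivisors.coe_ne_zero 𝔞 (by rw [h𝔟, mul_zero])
      exact ⟨⟨𝔟, mem_nonZeroDivisors_of_ne_zero h𝔟0⟩, Subtype.ext h𝔟.symm⟩
    have h1 : ∑' 𝔟, f (primeIdeal v) * (sievedIdeals S).indicator f 𝔟 = ∑' 𝔞, h 𝔞 := by
      rw [← hinj.tsum_eq hsupp]
      refine tsum_congr fun 𝔟 ↦ ?_
      have hiff : primeIdeal v * 𝔟 ∈ sievedIdeals S ↔ 𝔟 ∈ sievedIdeals S := by
        refine forall₂_congr fun w hw ↦ not_congr ?_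
        change w.asIdeal ∣ v.asIdeal * (𝔟 : Ideal R) ↔ _
        rw [w.prime.dvd_mul]
        refine or_iff_right fun hdvd ↦ hv ?_
        have : v.asIdeal = w.asIdeal :=
          ((v.isMaximal.eq_of_le w.isPrime.ne_top (Ideal.dvd_iff_le.mp hdvd)))
        rwa [HeightOneSpectrum.ext this]
      have hdvd : v.asIdeal ∣ ((primeIdeal v * 𝔟 : (Ideal R)⁰) : Ideal R) := dvd_mul_right _ _
      simp only [hh, if_pos hdvd, Set.indicator_apply, hiff, map_mul]
      split_ifs <;> simp
    have hs1 : Summable ((sievedIdeals S).indicator f) := hf.indicator _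
    have hs2 : Summable h := by
      have : h = {𝔞 : (Ideal R)⁰ | v.asIdeal ∣ (𝔞 : Ideal R)}.indicator
          ((sievedIdeals S).indicator f) := by
        ext 𝔞; simp [hh, Set.indicator_apply]
      rw [this]
      exact hs1.indicator _
    rw [h1, ← hs1.tsum_sub hs2]
    refine tsum_congr fun 𝔞 ↦ ?_
    simp only [hh, Set.indicator_apply, sievedIdeals, Finset.mem_insert, forall_eq_or_imp,
      Set.mem_ofPred_eq]
    by_cases h3 : v.asIdeal ∣ (𝔞 : Ideal R) <;> simp [h3]

/-- The Euler product of a summable completely multiplicative function on nonzero ideals. -/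
lemma tendsto_tsum_mul_prod_one_sub (f : (Ideal R)⁰ →* ℂ) (hf : Summable f) :
    Filter.Tendsto (fun S : Finset (HeightOneSpectrum R) ↦
      (∑' 𝔞, f 𝔞) * ∏ v ∈ S, (1 - f (primeIdeal v))) Filter.atTop (nhds 1) := by
  classical
  simp only [← tsum_indicator_sievedIdeals f hf]
  have hone : (1 : ℂ) = ∑' 𝔞 : (Ideal R)⁰, if 𝔞 = 1 then 1 else 0 := by simp
  rw [hone]
  refine tendsto_tsum_of_dominated_convergence hf.norm (fun 𝔞 ↦ ?_) ?_
  · rcases eq_or_ne 𝔞 1 with rfl | h𝔞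
    · have : ∀ S : Finset (HeightOneSpectrum R), (sievedIdeals S).indicator f 1 = 1 := fun S ↦ by
        rw [Set.indicator_of_mem, map_one]
        intro v _ hv
        exact v.isPrime.ne_top (Ideal.isUnit_iff.mp (isUnit_of_dvd_one hv))
      simp [this]
    · have h1 : (𝔞 : Ideal R) ≠ ⊤ := fun h ↦ h𝔞 (Subtype.ext (h.trans Ideal.one_eq_top.symm))
      obtain ⟨P, hP, hle⟩ := Ideal.exists_le_maximal _ h1
      have hP0 : P ≠ ⊥ := by
        rintro rfl
        exact nonZeroDivisors.coe_ne_zero 𝔞 (le_bot_iff.mp hle)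
      let v : HeightOneSpectrum R := ⟨P, hP.isPrime, hP0⟩
      rw [if_neg h𝔞]
      refine tendsto_const_nhds.congr' ?_
      filter_upwards [Filter.eventually_ge_atTop {v}] with S hS
      rw [Set.indicator_of_notMem]
      exact fun h ↦ h v (hS (Finset.mem_singleton_self v)) (Ideal.dvd_iff_le.mpr hle)
  · exact Filter.Eventually.of_forall fun S 𝔞 ↦ norm_indicator_le_norm_self _ _

end EulerProduct

section PrimeSums

open IsDedekindDomain

variable {K : Type*} [Field K] [NumberField K]

/-- The completely multiplicative function `χ(𝔞) θ(N𝔞) N𝔞^{-s}` on nonzero ideals. -/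
def classLTerm (χ : ClassGroup (𝓞 K) →* ℂˣ) (θ : ℕ →* ℂ) (s : ℝ) : (Ideal (𝓞 K))⁰ →* ℂ where
  toFun 𝔞 := (χ (ClassGroup.mk0 𝔞) : ℂ) * θ (Ideal.absNorm (𝔞 : Ideal (𝓞 K))) *
    (((Ideal.absNorm (𝔞 : Ideal (𝓞 K)) : ℝ) ^ (-s) : ℝ) : ℂ)
  map_one' := by simp
  map_mul' 𝔞 𝔟 := by
    simp only [map_mul, Submonoid.coe_mul, Nat.cast_mul, Units.val_mul,
      Real.mul_rpow (Nat.cast_nonneg _) (Nat.cast_nonneg _), Complex.ofReal_mul]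
    ring

lemma summable_classLTerm (χ : ClassGroup (𝓞 K) →* ℂˣ) (θ : ℕ →* ℂ) (hθ : ∀ k, ‖θ k‖ ≤ 1) {s : ℝ}
    (hs : Summable fun 𝔞 : (Ideal (𝓞 K))⁰ ↦ (Ideal.absNorm (𝔞 : Ideal (𝓞 K)) : ℝ) ^ (-s)) :
    Summable (classLTerm χ θ s) := by
  refine Summable.of_norm_bounded hs fun 𝔞 ↦ ?_
  have h0 : (0 : ℝ) ≤ (Ideal.absNorm (𝔞 : Ideal (𝓞 K)) : ℝ) ^ (-s) := by positivity
  change ‖(χ (ClassGroup.mk0 𝔞) : ℂ) * θ (Ideal.absNorm (𝔞 : Ideal (𝓞 K))) * _‖ ≤ _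
  rw [norm_mul, norm_mul, norm_classGroup_character, one_mul, Complex.norm_real,
    Real.norm_of_nonneg h0]
  exact mul_le_of_le_one_left h0 (hθ _)

lemma mem_of_dvd_absNorm {p : ℕ} (hp : p.Prime) (v : HeightOneSpectrum (𝓞 K))
    (h : p ∣ Ideal.absNorm v.asIdeal) : (p : 𝓞 K) ∈ v.asIdeal := by
  have : Fact p.Prime := ⟨hp⟩
  have _ := Ideal.finiteQuotientOfFreeOfNeBot v.asIdeal v.ne_bot
  rw [Ideal.absNorm_apply, Submodule.cardQuot_apply] at h
  obtain ⟨x, hx⟩ := exists_prime_addOrderOf_dvd_card' p h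
  have hx0 : x ≠ 0 := by
    rintro rfl
    rw [addOrderOf_zero] at hx
    exact hp.one_lt.ne hx
  have hpx : (p : 𝓞 K ⧸ v.asIdeal) * x = 0 := by
    rw [← nsmul_eq_mul, ← hx, addOrderOf_nsmul_eq_zero]
  have := (mul_eq_zero.mp hpx).resolve_right hx0
  rw [← Ideal.Quotient.eq_zero_iff_mem, map_natCast]
  exact this

lemma finite_setOf_dirichlet_absNorm_eq_zero {q : ℕ} (hq : q.Prime) (η : DirichletCharacter ℂ q) :
    {v : HeightOneSpectrum (𝓞 K) | η (Ideal.absNorm v.asIdeal : ℕ) = 0}.Finite := by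
  have hspan : Ideal.span {(q : 𝓞 K)} ≠ 0 := by
    simpa using hq.ne_zero
  refine (Ideal.finite_factors hspan).subset fun v hv ↦ ?_
  rw [Set.mem_ofPred_eq] at hv ⊢
  rw [Ideal.dvd_span_singleton]
  refine mem_of_dvd_absNorm hq v ?_
  by_contra h
  have h1 : IsUnit ((Ideal.absNorm v.asIdeal : ℕ) : ZMod q) :=
    (ZMod.isUnit_iff_coprime _ _).mpr ((Nat.Prime.coprime_iff_not_dvd hq).mpr h).symm
  exact (h1.map η).ne_zero hv

/-- The powers of a Dirichlet character as multiplicative maps on `ℕ`, the zeroth power being the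
constant function `1`. -/
def charPow {q : ℕ} (η : DirichletCharacter ℂ q) (i : ℕ) : ℕ →* ℂ :=
  (powMonoidHom i).comp (η.toMonoidHom.comp (Nat.castRingHom (ZMod q)).toMonoidHom)

lemma charPow_apply {q : ℕ} (η : DirichletCharacter ℂ q) (i k : ℕ) : charPow η i k = η k ^ i := rfl

lemma norm_charPow_le_one {q : ℕ} (η : DirichletCharacter ℂ q) (i k : ℕ) :
    ‖charPow η i k‖ ≤ 1 := by
  rw [charPow_apply, norm_pow]
  exact pow_le_one₀ (norm_nonneg _) (η.norm_le_one _)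

lemma norm_prod_one_sub_le {ℓ : ℕ} (hℓ : ℓ.Prime) {c z : ℂ} {x : ℝ} (hx0 : 0 ≤ x) (hx1 : x ≤ 1)
    (hc : c ^ ℓ = 1) (hz : z ^ ℓ = 1) (hcz : z = 1 → c = 1) :
    ‖∏ i ∈ Finset.range ℓ, (1 - c * z ^ i * x)‖ ≤ if z = 1 then Real.exp (-x) else 1 := by
  split_ifs with h
  · obtain rfl := hcz h
    subst h
    have h1 : ‖(1 : ℂ) - x‖ = 1 - x := by
      rw [← Complex.ofReal_one, ← Complex.ofReal_sub, Complex.norm_real,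
        Real.norm_of_nonneg (by linarith)]
    simp only [one_pow, one_mul, Finset.prod_const, Finset.card_range, norm_pow, h1]
    calc (1 - x) ^ ℓ ≤ (1 - x) ^ 1 :=
          pow_le_pow_of_le_one (by linarith) (by linarith) hℓ.one_le
      _ ≤ Real.exp (-x) := by rw [pow_one]; exact Real.one_sub_le_exp_neg x
  · have hprim : IsPrimitiveRoot z ℓ := by
      have : Fact ℓ.Prime := ⟨hℓ⟩
      rw [IsPrimitiveRoot.iff_orderOf]
      exact orderOf_eq_prime hz h
    have h1 := congrArg (Polynomial.eval 1)
      (X_pow_sub_C_eq_prod hprim hℓ.pos (rfl : (c * (x : ℂ)) ^ ℓ = (c * (x : ℂ)) ^ ℓ))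
    simp only [Polynomial.eval_sub, Polynomial.eval_pow, Polynomial.eval_X, Polynomial.eval_C,
      Polynomial.eval_prod, one_pow, mul_pow, hc, one_mul] at h1
    have h2 : ∀ i, c * z ^ i * (x : ℂ) = z ^ i * (c * x) := fun i ↦ by ring
    simp only [h2, ← h1]
    rw [← Complex.ofReal_pow, ← Complex.ofReal_one, ← Complex.ofReal_sub, Complex.norm_real,
      Real.norm_of_nonneg (sub_nonneg.mpr (pow_le_one₀ hx0 hx1))]
    linarith [pow_nonneg hx0 ℓ]

variable [IsTotallyReal K] {w₁ w₂ : InfinitePlace K}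

lemma exists_norm_classLSeries_charPow_le (hw : ∀ w, w = w₁ ∨ w = w₂) (hne : w₁ ≠ w₂)
    (hK : finrank ℚ K = 2) {q ℓ : ℕ} (hq : q.Prime) (hℓ : ℓ.Prime) (hℓodd : Odd ℓ)
    {η : DirichletCharacter ℂ q} (hη : orderOf η = ℓ) {χ : ClassGroup (𝓞 K) →* ℂˣ} (hχ : χ ≠ 1)
    {i : ℕ} (hi : i < ℓ) :
    ∃ C : ℝ, ∀ s ∈ Set.Ioc (1 : ℝ) 2, ‖classLSeries χ (charPow η i) s‖ ≤ C := by
  rcases eq_or_ne i 0 with rfl | hi0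
  · have : charPow η 0 = 1 := by ext k; simp [charPow_apply]
    rw [this]
    exact exists_norm_classLSeries_one_le hw hne hK hχ
  have hηℓ : η ^ ℓ = 1 := by rw [← hη, pow_orderOf_eq_one]
  have happly : ∀ u : (ZMod q)ˣ, ∀ j, (η ^ j) u = η u ^ j := fun u j ↦ MulChar.pow_apply_coe η j u
  have hη1 : η (-1) = 1 := by
    have h1 : η (-1) ^ 2 = 1 := by rw [← map_pow]; simp
    have h2 : η (-1) ^ ℓ = 1 := by
      have := happly (-1) ℓ
      rw [hηℓ, MulChar.one_apply_coe, Units.val_neg, Units.val_one] at this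
      exact this.symm
    obtain ⟨k, hk⟩ := hℓodd
    rwa [hk, pow_succ, pow_mul, h1, one_pow, one_mul] at h2
  have hsq : η ^ (i * 2) ≠ 1 := by
    rw [Ne, ← orderOf_dvd_iff_pow_eq_one, hη, hℓ.dvd_mul]
    rintro (h | h)
    · exact absurd (Nat.le_of_dvd (Nat.pos_of_ne_zero hi0) h) (by omega)
    · have := (Nat.prime_dvd_prime_iff_eq hℓ Nat.prime_two).mp h
      subst this
      exact absurd hℓodd (by decide)
  obtain ⟨u, hu⟩ := MulChar.ne_one_iff.mp hsq
  have : NeZero q := ⟨hq.ne_zero⟩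
  have hcast : (((u : ZMod q).val : ℕ) : ZMod q) = u := ZMod.natCast_zmod_val _
  refine exists_norm_classLSeries_dirichlet_le hw hne hK hq (η ^ i) ?_ (g := (u : ZMod q).val) ?_
    (ZMod.val_coe_unit_coprime u) _ (fun k ↦ ?_) χ
  · have := happly (-1) i
    rw [Units.val_neg, Units.val_one] at this
    rw [this, hη1, one_pow]
  · rw [hcast, happly, ← pow_mul, ← happly]
    exact hu
  · rw [charPow_apply, MulChar.pow_apply' _ hi0]

/-- If `χ` is trivial on all primes whose norm is in the kernel of `η`, then the sum of the
inverse norms of these primes converges. -/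
lemma exists_sum_inv_absNorm_le (hw : ∀ w, w = w₁ ∨ w = w₂) (hne : w₁ ≠ w₂)
    (hK : finrank ℚ K = 2) {q ℓ : ℕ} (hq : q.Prime) (hℓ : ℓ.Prime) (hℓodd : Odd ℓ)
    {η : DirichletCharacter ℂ q} (hη : orderOf η = ℓ) {χ : ClassGroup (𝓞 K) →* ℂˣ} (hχ : χ ≠ 1)
    (hχℓ : χ ^ ℓ = 1)
    (hηχ : ∀ v : HeightOneSpectrum (𝓞 K), η (Ideal.absNorm v.asIdeal : ℕ) = 1 →
      χ (ClassGroup.mk0 (primeIdeal v)) = 1) :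
    ∃ C : ℝ, ∀ S₀ : Finset (HeightOneSpectrum (𝓞 K)),
      (∀ v ∈ S₀, η (Ideal.absNorm v.asIdeal : ℕ) = 1) →
      ∑ v ∈ S₀, ((Ideal.absNorm v.asIdeal : ℕ) : ℝ)⁻¹ ≤ C := by
  classical
  have hηℓ : η ^ ℓ = 1 := by rw [← hη, pow_orderOf_eq_one]
  obtain ⟨C, hC⟩ : ∃ C : ℕ → ℝ, ∀ i < ℓ, ∀ s ∈ Set.Ioc (1 : ℝ) 2,
      ‖classLSeries χ (charPow η i) s‖ ≤ C i := by
    choose! C hC using fun i (hi : i < ℓ) ↦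
      exists_norm_classLSeries_charPow_le hw hne hK hq hℓ hℓodd hη hχ hi
    exact ⟨C, hC⟩
  set Q := (finite_setOf_dirichlet_absNorm_eq_zero (K := K) hq η).toFinset with hQ
  have hpos : ∀ v : HeightOneSpectrum (𝓞 K), 1 ≤ Ideal.absNorm v.asIdeal := fun v ↦
    Nat.one_le_iff_ne_zero.mpr (by simpa [Ideal.absNorm_eq_zero_iff] using v.ne_bot)
  refine ⟨(∏ i ∈ Finset.range ℓ, C i) * 2 ^ Q.card, fun S₀ hS₀ ↦ ?_⟩
  have key : ∀ s ∈ Set.Ioc (1 : ℝ) 2,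
      ∑ v ∈ S₀, ((Ideal.absNorm v.asIdeal : ℕ) : ℝ) ^ (-s) ≤
        (∏ i ∈ Finset.range ℓ, C i) * 2 ^ Q.card := by
    intro s hs
    set x : HeightOneSpectrum (𝓞 K) → ℝ := fun v ↦ ((Ideal.absNorm v.asIdeal : ℕ) : ℝ) ^ (-s)
      with hx
    have hx0 : ∀ v, 0 ≤ x v := fun v ↦ by positivity
    have hx1 : ∀ v, x v ≤ 1 := fun v ↦
      Real.rpow_le_one_of_one_le_of_nonpos (by exact_mod_cast hpos v) (by linarith [hs.1])
    set f : ℕ → (Ideal (𝓞 K))⁰ →* ℂ := fun i ↦ classLTerm χ (charPow η i) s with hf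
    have hfv : ∀ i v, f i (primeIdeal v) =
        (χ (ClassGroup.mk0 (primeIdeal v)) : ℂ) * η (Ideal.absNorm v.asIdeal : ℕ) ^ i * x v :=
      fun i v ↦ rfl
    have hlim : Filter.Tendsto (fun S : Finset (HeightOneSpectrum (𝓞 K)) ↦
        ‖∏ i ∈ Finset.range ℓ, ((∑' 𝔞, f i 𝔞) * ∏ v ∈ S, (1 - f i (primeIdeal v)))‖)
        Filter.atTop (nhds 1) := by
      have := (tendsto_finsetProd (Finset.range ℓ) fun i _ ↦
        tendsto_tsum_mul_prod_one_sub (f i) (summable_classLTerm χ _ (norm_charPow_le_one η i)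
          (summable_absNorm_rpow hw hne hK hs.1))).norm
      simpa using this
    set B : HeightOneSpectrum (𝓞 K) → ℝ := fun v ↦
      (if v ∈ Q then 2 else 1) * (if v ∈ S₀ then Real.exp (-x v) else 1) with hB
    have hDB : ∀ v, ‖∏ i ∈ Finset.range ℓ, (1 - f i (primeIdeal v))‖ ≤ B v := by
      intro v
      simp only [hfv]
      by_cases h0 : η (Ideal.absNorm v.asIdeal : ℕ) = 0
      · have hvQ : v ∈ Q := by simpa [hQ] using h0
        have hvS : v ∉ S₀ := fun h ↦ by simp [hS₀ v h] at h0
        rw [Finset.prod_eq_single_of_mem 0 (Finset.mem_range.mpr hℓ.pos)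
          (fun i _ hi ↦ by simp [h0, hi])]
        simp only [hB, hvQ, hvS, if_true, if_false, mul_one, pow_zero]
        refine (norm_sub_le _ _).trans ?_
        rw [norm_mul, norm_classGroup_character, norm_one, one_mul, Complex.norm_real,
          Real.norm_of_nonneg (hx0 v)]
        linarith [hx1 v]
      · have hvQ : v ∉ Q := by simpa [hQ] using h0
        have hunit : IsUnit ((Ideal.absNorm v.asIdeal : ℕ) : ZMod q) := by
          by_contra h
          exact h0 (η.map_nonunit h)
        obtain ⟨u, hu⟩ := hunit
        have hz : η (Ideal.absNorm v.asIdeal : ℕ) ^ ℓ = 1 := by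
          rw [← hu, ← MulChar.pow_apply_coe, hηℓ, MulChar.one_apply_coe]
        have hc : (χ (ClassGroup.mk0 (primeIdeal v)) : ℂ) ^ ℓ = 1 := by
          have := DFunLike.congr_fun hχℓ (ClassGroup.mk0 (primeIdeal v))
          rw [MonoidHom.pow_apply, MonoidHom.one_apply] at this
          rw [← Units.val_pow_eq_pow_val, this, Units.val_one]
        refine (norm_prod_one_sub_le hℓ (hx0 v) (hx1 v) hc hz fun h ↦ by
          rw [hηχ v h, Units.val_one]).trans ?_
        simp only [hB, hvQ, if_false, one_mul]
        split_ifs with h1 h2 h2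
        · exact le_rfl
        · exact Real.exp_le_one_iff.mpr (by linarith [hx0 v])
        · exact absurd (hS₀ v h2) h1
        · exact le_rfl
    have hle : 1 ≤ (∏ i ∈ Finset.range ℓ, C i) * 2 ^ Q.card * Real.exp (-∑ v ∈ S₀, x v) := by
      refine le_of_tendsto hlim ?_
      filter_upwards [Filter.eventually_ge_atTop (S₀ ∪ Q)] with S hS
      rw [Finset.prod_mul_distrib, Finset.prod_comm, norm_mul, norm_prod, norm_prod, mul_assoc]
      have hprodB : ∏ v ∈ S, B v = 2 ^ Q.card * Real.exp (-∑ v ∈ S₀, x v) := by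
        rw [hB, Finset.prod_mul_distrib, Finset.prod_ite_mem, Finset.prod_ite_mem,
          Finset.inter_eq_right.mpr (Finset.subset_union_right.trans hS),
          Finset.inter_eq_right.mpr (Finset.subset_union_left.trans hS), Finset.prod_const,
          ← Finset.sum_neg_distrib, Real.exp_sum]
      rw [← hprodB]
      refine mul_le_mul (Finset.prod_le_prod (fun _ _ ↦ norm_nonneg _) fun i hi ↦
        hC i (Finset.mem_range.mp hi) s hs) (Finset.prod_le_prod (fun _ _ ↦ norm_nonneg _)
        fun v _ ↦ hDB v) (Finset.prod_nonneg fun _ _ ↦ norm_nonneg _)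
        (Finset.prod_nonneg fun i hi ↦ (norm_nonneg _).trans (hC i (Finset.mem_range.mp hi) s hs))
    rw [Real.exp_neg, ← div_eq_mul_inv, one_le_div (Real.exp_pos _)] at hle
    linarith [Real.add_one_le_exp (∑ v ∈ S₀, x v)]
  have hcont : Filter.Tendsto
      (fun s : ℝ ↦ ∑ v ∈ S₀, ((Ideal.absNorm v.asIdeal : ℕ) : ℝ) ^ (-s))
      (nhdsWithin 1 (Set.Ioi 1)) (nhds (∑ v ∈ S₀, ((Ideal.absNorm v.asIdeal : ℕ) : ℝ)⁻¹)) := by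
    refine tendsto_finsetSum _ fun v _ ↦ ?_
    rw [← Real.rpow_neg_one]
    have h0 : ((Ideal.absNorm v.asIdeal : ℕ) : ℝ) ≠ 0 := by
      exact_mod_cast (Nat.one_le_iff_ne_zero.mp (hpos v))
    exact ((Real.continuousAt_const_rpow h0).comp continuousAt_neg).tendsto.mono_left
      nhdsWithin_le_nhds
  refine le_of_tendsto hcont ?_
  filter_upwards [Ioc_mem_nhdsGT (one_lt_two : (1 : ℝ) < 2)] with s hs using key s hs

end PrimeSums

section Dirichlet

open ArithmeticFunction.vonMangoldt in
/-- The sum of the inverses of the primes congruent to `1` modulo `n` diverges. -/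
lemma not_summable_inv_prime_eq_one_mod (n : ℕ) [NeZero n] :
    ¬ Summable fun p : ℕ ↦ if p.Prime ∧ (p : ZMod n) = 1 then (p : ℝ)⁻¹ else 0 := by
  intro hsum
  set g : ℕ → ℝ := fun p ↦ if p.Prime ∧ (p : ZMod n) = 1 then (p : ℝ)⁻¹ else 0 with hg
  have hg0 : ∀ k, 0 ≤ g k := fun k ↦ by simp only [hg]; split_ifs <;> positivity
  obtain ⟨C, hC⟩ := LSeries_residueClass_lower_bound (isUnit_one : IsUnit (1 : ZMod n))
  set δ : ℝ := (n.totient : ℝ)⁻¹ with hδ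
  have hδ0 : 0 < δ := inv_pos.mpr (mod_cast n.totient.pos_of_neZero)
  obtain ⟨T, hT⟩ := (hsum.hasSum.eventually (lt_mem_nhds
    (show ∑' p, g p - δ / 2 < ∑' p, g p by linarith))).exists
  set a : ℕ → ℝ := fun k ↦ (if k.Prime then 0 else residueClass (1 : ZMod n) k) / k with ha
  have hasum : Summable a := summable_residueClass_non_primes_div 1
  have ha0 : ∀ k, 0 ≤ a k := fun k ↦ by
    have := residueClass_nonneg (1 : ZMod n) k
    simp only [ha]
    split_ifs <;> positivity
  set D : ℝ := ∑' k, a k + ∑ k ∈ T, g k * Real.log k with hD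
  have key : ∀ x ∈ Set.Ioc (1 : ℝ) 2, δ / 2 ≤ (C + D) * (x - 1) := by
    intro x hx
    have hx1 : 0 < x - 1 := sub_pos.mpr hx.1
    have hbound : ∀ k : ℕ, residueClass (1 : ZMod n) k / (k : ℝ) ^ x ≤
        a k + (if k ∈ T then g k * Real.log k else 0) +
          (g k / (x - 1) - if k ∈ T then g k / (x - 1) else 0) := by
      intro k
      have hr := residueClass_nonneg (1 : ZMod n) k
      rcases Nat.eq_zero_or_pos k with rfl | hk
      · simp [ha, hg]
      have hk1 : (1 : ℝ) ≤ k := by exact_mod_cast hk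
      have hpow : (k : ℝ) ^ x = k * (k : ℝ) ^ (x - 1) := by
        rw [← Real.rpow_one_add' (by positivity) (by linarith)]
        ring_nf
      have hpow1 : 1 ≤ (k : ℝ) ^ (x - 1) := Real.one_le_rpow hk1 hx1.le
      have hlog : 0 ≤ Real.log k := Real.log_nonneg hk1
      have hrest : 0 ≤ (if k ∈ T then g k * Real.log k else 0) +
          (g k / (x - 1) - if k ∈ T then g k / (x - 1) else 0) := by
        split_ifs
        · simpa using mul_nonneg (hg0 k) hlog
        · simpa using div_nonneg (hg0 k) hx1.le
      by_cases hp : k.Prime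
      · by_cases h1 : (k : ZMod n) = 1
        · have hres : residueClass (1 : ZMod n) k = Real.log k := by
            rw [residueClass, Set.indicator_of_mem (by exact h1),
              ArithmeticFunction.vonMangoldt_apply_prime hp]
          have hgk : g k = (k : ℝ)⁻¹ := if_pos ⟨hp, h1⟩
          have hak : a k = 0 := by simp [ha, hp]
          rw [hres, hak, zero_add, hpow]
          split_ifs
          · rw [sub_self, add_zero, hgk, mul_comm (k : ℝ)⁻¹, ← div_eq_mul_inv]
            exact div_le_div_of_nonneg_left hlog (by positivity)
              (le_mul_of_one_le_right (by positivity) hpow1)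
          · rw [zero_add, sub_zero, hgk, inv_div_left, div_le_iff₀ (by positivity)]
            have := Real.log_le_rpow_div (x := k) (by positivity) hx1
            refine this.trans (le_of_eq ?_)
            field_simp
        · have hres : residueClass (1 : ZMod n) k = 0 :=
            Set.indicator_of_notMem (by exact h1) _
          rw [hres, zero_div, add_assoc]
          exact add_nonneg (ha0 k) hrest
      · have hak : a k = residueClass (1 : ZMod n) k / k := by simp [ha, hp]
        have h1 : residueClass (1 : ZMod n) k / (k : ℝ) ^ x ≤ a k := by
          rw [hak, hpow]
          exact div_le_div_of_nonneg_left hr (by positivity)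
            (le_mul_of_one_le_right (by positivity) hpow1)
        rw [add_assoc]
        linarith
    have hsumT : ∀ f : ℕ → ℝ, HasSum (fun k ↦ if k ∈ T then f k else 0) (∑ k ∈ T, f k) := by
      intro f
      rw [Finset.sum_congr rfl fun k (hk : k ∈ T) ↦ (if_pos hk).symm]
      exact hasSum_sum_of_ne_finset_zero fun k hk ↦ if_neg hk
    have hrhs := (hasum.hasSum.add (hsumT fun k ↦ g k * Real.log k)).add
      ((hsum.hasSum.div_const (x - 1)).sub (hsumT fun k ↦ g k / (x - 1)))
    have hle : ∑' k : ℕ, residueClass (1 : ZMod n) k / (k : ℝ) ^ x ≤ D + δ / 2 / (x - 1) := by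
      have hs : Summable fun k : ℕ ↦ residueClass (1 : ZMod n) k / (k : ℝ) ^ x :=
        Summable.of_nonneg_of_le
          (fun k ↦ div_nonneg (residueClass_nonneg _ _) (by positivity)) hbound hrhs.summable
      refine (hs.tsum_le_tsum hbound hrhs.summable).trans ?_
      rw [hrhs.tsum_eq, ← Finset.sum_div, ← sub_div]
      have : (∑' k, g k - ∑ k ∈ T, g k) / (x - 1) ≤ δ / 2 / (x - 1) :=
        div_le_div_of_nonneg_right (by linarith) hx1.le
      linarith
    have h1 := (hC hx).trans hle
    have h2 : δ / 2 / (x - 1) ≤ C + D := by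
      have : δ / (x - 1) = δ / 2 / (x - 1) + δ / 2 / (x - 1) := by ring
      linarith
    rwa [div_le_iff₀ hx1] at h2
  have hpos : 0 < C + D := by
    have := key 2 ⟨one_lt_two, le_rfl⟩
    linarith
  have hmin : 0 < min 1 (δ / 4 / (C + D)) := by positivity
  have h1 := key (1 + min 1 (δ / 4 / (C + D)))
    ⟨by linarith, by linarith [min_le_left 1 (δ / 4 / (C + D))]⟩
  have h2 : (C + D) * min 1 (δ / 4 / (C + D)) ≤ (C + D) * (δ / 4 / (C + D)) :=
    mul_le_mul_of_nonneg_left (min_le_right _ _) hpos.le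
  rw [mul_div_cancel₀ _ hpos.ne'] at h2
  rw [add_sub_cancel_left] at h1
  linarith

end Dirichlet

section Frobenius

lemma card_le_of_forall_pow_eq (A : Type*) [CommRing A] [IsDomain A] [Finite A] {k : ℕ} (hk : 1 < k)
    (h : ∀ x : A, x ^ k = x) : Nat.card A ≤ k := by
  have := Fintype.ofFinite A
  classical
  have hdeg : (Polynomial.X ^ k - Polynomial.X : Polynomial A).natDegree = k := by
    rw [Polynomial.natDegree_sub_eq_left_of_natDegree_lt] <;> simp [hk]
  have hne : (Polynomial.X ^ k - Polynomial.X : Polynomial A) ≠ 0 := by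
    rintro h0
    rw [h0, Polynomial.natDegree_zero] at hdeg
    omega
  have hsub : (Finset.univ : Finset A) ⊆
      (Polynomial.X ^ k - Polynomial.X : Polynomial A).roots.toFinset := by
    intro x _
    rw [Multiset.mem_toFinset, Polynomial.mem_roots hne]
    simp [h x]
  rw [Nat.card_eq_fintype_card, ← Finset.card_univ]
  exact (Finset.card_le_card hsub).trans ((Multiset.toFinset_card_le _).trans
    ((Polynomial.card_roots' _).trans hdeg.le))

variable {R S T : Type*} (G : Type*) [CommRing R] [CommRing S] [CommRing T]
    [Algebra R S] [Algebra S T] [Algebra R T] [IsScalarTower R S T] [Group G] [Finite G]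
    [MulSemiringAction G T] [SMulCommClass G R T] [Algebra.IsInvariant R T G]

/-- If the Frobenius elements at `P` fix the subring `S`, then `P` has the same residue field in `S`
as in the base ring. -/
lemma card_quotient_under_eq (P : Ideal T) [P.IsPrime] [Finite (T ⧸ P)]
    (h : ∀ σ : G, IsArithFrobAt R σ P → ∀ x : S, σ • algebraMap S T x = algebraMap S T x) :
    Nat.card (S ⧸ P.under S) = Nat.card (R ⧸ P.under R) := by
  obtain ⟨σ, hσ⟩ := IsArithFrobAt.exists_of_isInvariant R G P
  have hR : Finite (R ⧸ P.under R) := hσ.finite_quotient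
  have hS : Finite (S ⧸ P.under S) :=
    Finite.of_injective (algebraMap (S ⧸ P.under S) (T ⧸ P)) Ideal.algebraMap_quotient_injective
  refine le_antisymm (card_le_of_forall_pow_eq _ Finite.one_lt_card fun x ↦ ?_) ?_
  · obtain ⟨x, rfl⟩ := Ideal.Quotient.mk_surjective x
    rw [← map_pow, Ideal.Quotient.eq, Ideal.under, Ideal.mem_comap, map_sub, map_pow]
    have := hσ (algebraMap S T x)
    rw [MulSemiringAction.toAlgHom_apply, h σ hσ] at this
    rw [← neg_sub]
    exact neg_mem this
  · have hcomap : P.under R = (P.under S).comap (algebraMap R S) := by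
      rw [Ideal.under, Ideal.under, Ideal.comap_comap, ← IsScalarTower.algebraMap_eq]
    exact Nat.card_le_card_of_injective _
      (Ideal.quotientMap_injective' (f := algebraMap R S) (H := hcomap.le) hcomap.ge)

lemma exists_liesOver_card_quotient_eq [IsDomain T] [Nontrivial R] [FaithfulSMul R T]
    [Ring.HasFiniteQuotients T] {ζ : T} {k : ℕ} (hζ : ζ ^ k = 1) {p : Ideal R} [p.IsMaximal]
    (hp : p ≠ ⊥) (hkp : (k : R) ∉ p)
    (h : ∀ σ : G, σ • ζ = ζ ^ Nat.card (R ⧸ p) →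
      ∀ x : S, σ • algebraMap S T x = algebraMap S T x) :
    ∃ P : Ideal S, P.IsPrime ∧ P.LiesOver p ∧ Nat.card (S ⧸ P) = Nat.card (R ⧸ p) := by
  have := Algebra.IsInvariant.isIntegral R T G
  obtain ⟨Q, hQ, hQp⟩ := Ideal.exists_maximal_ideal_liesOver_of_isIntegral (S := T) p
  have hQ0 : Q ≠ ⊥ := Ideal.ne_bot_of_liesOver_of_ne_bot hp Q
  have : Finite (T ⧸ Q) := Ring.HasFiniteQuotients.finiteQuotient hQ0
  have hunder : Q.under R = p := hQp.over.symm
  refine ⟨Q.under S, inferInstance, ⟨?_⟩, ?_⟩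
  · rw [Ideal.under_under, hunder]
  rw [card_quotient_under_eq (R := R) G Q fun σ hσ ↦ h σ ?_, hunder]
  rw [← hunder]
  refine AlgHom.IsArithFrobAt.apply_of_pow_eq_one hσ hζ fun hk ↦ hkp ?_
  rw [← hunder, Ideal.under, Ideal.mem_comap, map_natCast]
  exact hk

end Frobenius

section Cyclotomic

lemma isPrimitiveRoot_zetaC {n : ℕ} (hn : n ≠ 0) : IsPrimitiveRoot (zetaC n) n :=
  Complex.isPrimitiveRoot_exp n hn

instance finiteDimensional_adjoin_zetaC (n : ℕ) [NeZero n] : FiniteDimensional ℚ ℚ⟮zetaC n⟯ :=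
  IntermediateField.adjoin.finiteDimensional
    (isIntegral_of_pow_eq_one (NeZero.ne n) (zetaC_pow n (NeZero.ne n)))

instance isCyclotomicExtension_adjoin_zetaC (n : ℕ) [NeZero n] :
    IsCyclotomicExtension {n} ℚ ℚ⟮zetaC n⟯ := by
  change IsCyclotomicExtension {n} ℚ (ℚ⟮zetaC n⟯).toSubalgebra
  rw [adjoin_simple_toSubalgebra_of_isAlgebraic
    (isIntegral_of_pow_eq_one (NeZero.ne n) (zetaC_pow n (NeZero.ne n))).isAlgebraic]
  exact (isPrimitiveRoot_zetaC (NeZero.ne n)).adjoin_isCyclotomicExtension ℚ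

/-- An embedding acting on `ζ_q` through an `ℓ`-th power of `(ℤ/q)ˣ` fixes the subfields of degree
`ℓ` over `ℚ`. -/
lemma apply_eq_of_finrank_eq {q ℓ : ℕ} [NeZero q] {E : IntermediateField ℚ ℂ} (hE : E ≤ ℚ⟮zetaC q⟯)
    (hfin : finrank ℚ E = ℓ) (u : (ZMod q)ˣ) (φ : ℚ⟮zetaC q⟯ →ₐ[ℚ] ℂ) {k : ℕ}
    (hk : (k : ZMod q) = u ^ ℓ)
    (hφ : φ (AdjoinSimple.gen ℚ (zetaC q)) = zetaC q ^ k) (x : ℚ⟮zetaC q⟯) (hx : (x : ℂ) ∈ E) :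
    φ x = x := by
  have : IsAbelianGalois ℚ ℚ⟮zetaC q⟯ := IsCyclotomicExtension.isAbelianGalois {q} ℚ _
  have : NumberField ℚ⟮zetaC q⟯ := inferInstance
  set τ := (IsCyclotomicExtension.Rat.galEquivZMod q ℚ⟮zetaC q⟯).symm u with hτ
  set E' : IntermediateField ℚ ℚ⟮zetaC q⟯ := IntermediateField.restrict hE with hE'
  have hindex : E'.fixingSubgroup.index = ℓ := by
    rw [← finrank_eq_fixingSubgroup_index, ← hfin]
    exact (restrictAlgEquiv hE).toLinearEquiv.finrank_eq.symm
  have hmem : τ ^ ℓ ∈ E'.fixingSubgroup := by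
    rw [← hindex]
    exact Subgroup.pow_index_mem _ τ
  have hgen : (AdjoinSimple.gen ℚ (zetaC q)) ^ q = 1 := by
    apply Subtype.val_injective
    simpa using zetaC_pow q (NeZero.ne q)
  have heq : φ = (ℚ⟮zetaC q⟯).val.comp
      ((τ ^ ℓ : Gal(ℚ⟮zetaC q⟯/ℚ)) : ℚ⟮zetaC q⟯ →ₐ[ℚ] ℚ⟮zetaC q⟯) := by
    refine adjoin_algHom_ext ℚ fun y hy ↦ ?_
    rw [Set.mem_singleton_iff] at hy
    subst hy
    refine hφ.trans ?_
    have h1 := IsCyclotomicExtension.Rat.galEquivZMod_apply_of_pow_eq q ℚ⟮zetaC q⟯ (τ ^ ℓ) hgen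
    rw [map_pow, hτ, MulEquiv.apply_symm_apply, Units.val_pow_eq_pow_val, ← hk] at h1
    refine Eq.trans ?_ (congrArg Subtype.val h1).symm
    rw [SubmonoidClass.coe_pow, AdjoinSimple.coe_gen, ZMod.val_natCast,
      ← pow_eq_pow_mod k (zetaC_pow q (NeZero.ne q))]
  rw [heq]
  have := (mem_fixingSubgroup_iff _ _).mp hmem x ((mem_restrict hE x).mpr hx)
  exact congrArg Subtype.val this

end Cyclotomic

section Splitting

lemma realCyclo_le (n : ℕ) : realCyclo n ≤ ℚ⟮zetaC n⟯ := by
  rw [realCyclo, adjoin_simple_le_iff]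
  exact add_mem (mem_adjoin_simple_self ℚ _) (inv_mem (mem_adjoin_simple_self ℚ _))

lemma adjoin_zetaC_le_of_dvd {q n : ℕ} [NeZero n] (h : q ∣ n) : ℚ⟮zetaC q⟯ ≤ ℚ⟮zetaC n⟯ := by
  obtain ⟨d, rfl⟩ := h
  have hne := NeZero.ne (q * d)
  have hq : (q : ℂ) ≠ 0 := Nat.cast_ne_zero.mpr (left_ne_zero_of_mul hne)
  have hd : (d : ℂ) ≠ 0 := Nat.cast_ne_zero.mpr (right_ne_zero_of_mul hne)
  have : zetaC q = zetaC (q * d) ^ d := by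
    rw [zetaC, zetaC, ← Complex.exp_nat_mul]
    congr 1
    push_cast
    field_simp
  rw [adjoin_simple_le_iff, this]
  exact pow_mem (mem_adjoin_simple_self ℚ _) d

lemma natCard_quotient_eq_absNorm {K : Type*} [Field K] [NumberField K] (I : Ideal (𝓞 K)) :
    Nat.card (𝓞 K ⧸ I) = Ideal.absNorm I := by
  rw [Ideal.absNorm_apply, Submodule.cardQuot_apply]

/-- The root of unity `ζ_m` as an algebraic integer. -/
def zetaInt {m : ℕ} [NeZero m] {M : IntermediateField ℚ ℂ} (h : ℚ⟮zetaC m⟯ ≤ M) : 𝓞 M :=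
  ⟨⟨zetaC m, h (mem_adjoin_simple_self ℚ _)⟩, ⟨Polynomial.X ^ m - Polynomial.C 1,
    Polynomial.monic_X_pow_sub_C 1 (NeZero.ne m), by
      simp only [Polynomial.eval₂_sub, Polynomial.eval₂_pow, Polynomial.eval₂_X,
        map_one, Polynomial.eval₂_one, sub_eq_zero]
      exact Subtype.ext (zetaC_pow m (NeZero.ne m))⟩⟩

lemma zetaInt_pow {m : ℕ} [NeZero m] {M : IntermediateField ℚ ℂ} (h : ℚ⟮zetaC m⟯ ≤ M) :
    zetaInt h ^ m = 1 :=
  RingOfIntegers.ext (Subtype.ext (zetaC_pow m (NeZero.ne m)))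

lemma exists_absNorm_eq_of_eq_one_mod {n p : ℕ} [NeZero n] (hp : p.Prime) (hpn : (p : ZMod n) = 1)
    {K : IntermediateField ℚ ℂ} [FiniteDimensional ℚ K] (hK : K ≤ ℚ⟮zetaC n⟯) :
    ∃ P : Ideal (𝓞 K), P.IsPrime ∧ P ≠ ⊥ ∧ Ideal.absNorm P = p := by
  let _ : Algebra K ℚ⟮zetaC n⟯ := (inclusion hK).toAlgebra
  have := IsCyclotomicExtension.isGalois {n} ℚ ℚ⟮zetaC n⟯
  have := IsGaloisGroup.of_isFractionRing Gal(ℚ⟮zetaC n⟯/ℚ) ℤ (𝓞 ℚ⟮zetaC n⟯) ℚ ℚ⟮zetaC n⟯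
  have hpmax : (Ideal.span {(p : ℤ)}).IsMaximal :=
    PrincipalIdealRing.isMaximal_of_irreducible (Nat.prime_iff_prime_int.mp hp).irreducible
  have hp0 : Ideal.span {(p : ℤ)} ≠ ⊥ := by simpa using hp.ne_zero
  have hcard : Nat.card (ℤ ⧸ Ideal.span {(p : ℤ)}) = p := by
    rw [Nat.card_congr (Int.quotientSpanNatEquivZMod p).toEquiv, Nat.card_zmod]
  have hnp : ((n : ℕ) : ℤ) ∉ Ideal.span {(p : ℤ)} := by
    rw [Ideal.mem_span_singleton, Int.natCast_dvd_natCast]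
    intro h
    have h1 : n ∣ p - 1 := by
      rw [← ZMod.natCast_eq_zero_iff, Nat.cast_sub hp.one_le, hpn, Nat.cast_one, sub_self]
    exact absurd (Nat.le_of_dvd (Nat.sub_pos_of_lt hp.one_lt) (h.trans h1))
      (by have := hp.one_lt; omega)
  obtain ⟨P, hP, hPp, hcardP⟩ := exists_liesOver_card_quotient_eq (S := 𝓞 K) Gal(ℚ⟮zetaC n⟯/ℚ)
    (zetaInt_pow (le_refl ℚ⟮zetaC n⟯)) hp0 hnp (fun σ hσ x ↦ by
      rw [hcard] at hσ
      have hid : ∀ y : ℚ⟮zetaC n⟯, σ y = y := by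
        have : (σ : ℚ⟮zetaC n⟯ →ₐ[ℚ] ℚ⟮zetaC n⟯) = AlgHom.id ℚ ℚ⟮zetaC n⟯ := by
          refine adjoin_algHom_ext ℚ fun y hy ↦ ?_
          rw [Set.mem_singleton_iff] at hy
          subst hy
          have h1 : zetaInt (le_refl ℚ⟮zetaC n⟯) ^ p = zetaInt (le_refl ℚ⟮zetaC n⟯) := by
            have hmod : p % n = 1 % n :=
              (ZMod.natCast_eq_natCast_iff' p 1 n).mp (by rw [hpn, Nat.cast_one])
            rw [pow_eq_pow_mod p (zetaInt_pow _), hmod, ← pow_eq_pow_mod 1 (zetaInt_pow _), pow_one]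
          rw [h1] at hσ
          exact congrArg (algebraMap (𝓞 ℚ⟮zetaC n⟯) ℚ⟮zetaC n⟯) hσ
        exact fun y ↦ DFunLike.congr_fun this y
      exact RingOfIntegers.ext (hid _))
  refine ⟨P, hP, Ideal.ne_bot_of_liesOver_of_ne_bot hp0 P, ?_⟩
  rw [← natCard_quotient_eq_absNorm, hcardP, hcard]

lemma exists_liesOver_absNorm_eq {n q ℓ : ℕ} [NeZero n] (hq : q.Prime) (hqn : q ∣ n)
    {K E : IntermediateField ℚ ℂ} [FiniteDimensional ℚ K] [FiniteDimensional ℚ E]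
    (hK : K ≤ ℚ⟮zetaC n⟯) (hE : E ≤ ℚ⟮zetaC q⟯) (hfin : finrank ℚ E = ℓ)
    [Algebra K ↥(K ⊔ E)] [IsScalarTower K ↥(K ⊔ E) ℂ] {v : Ideal (𝓞 K)} [v.IsPrime] (hv : v ≠ ⊥)
    (u : (ZMod q)ˣ) (hu : (Ideal.absNorm v : ZMod q) = u ^ ℓ) :
    ∃ P : Ideal (𝓞 ↥(K ⊔ E)), P.IsPrime ∧ P.LiesOver v ∧ Ideal.absNorm P = Ideal.absNorm v := by
  have : NeZero q := ⟨hq.ne_zero⟩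
  have hqM := adjoin_zetaC_le_of_dvd hqn
  have hL : K ⊔ E ≤ ℚ⟮zetaC n⟯ := sup_le hK (hE.trans hqM)
  let _ : Algebra K ℚ⟮zetaC n⟯ := (inclusion hK).toAlgebra
  let _ : Algebra ↥(K ⊔ E) ℚ⟮zetaC n⟯ := (inclusion hL).toAlgebra
  have : IsScalarTower K ↥(K ⊔ E) ℚ⟮zetaC n⟯ := IsScalarTower.of_algebraMap_eq fun x ↦
    Subtype.ext (IsScalarTower.algebraMap_apply K ↥(K ⊔ E) ℂ x)
  have := IsCyclotomicExtension.isGalois {n} ℚ ℚ⟮zetaC n⟯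
  have : IsGalois K ℚ⟮zetaC n⟯ := IsGalois.tower_top_of_isGalois ℚ K _
  have := IsGaloisGroup.of_isFractionRing Gal(ℚ⟮zetaC n⟯/K) (𝓞 K) (𝓞 ℚ⟮zetaC n⟯) K ℚ⟮zetaC n⟯
  have hvmax : v.IsMaximal := Ideal.IsPrime.isMaximal inferInstance hv
  have hqv : ((q : ℕ) : 𝓞 K) ∉ v := by
    intro h
    have h1 : IsCoprime (q : ℤ) (Ideal.absNorm v : ℤ) := by
      have : IsUnit ((Ideal.absNorm v : ℕ) : ZMod q) := by
        rw [hu]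
        exact (u ^ ℓ).isUnit
      exact Nat.isCoprime_iff_coprime.mpr ((ZMod.isUnit_iff_coprime _ _).mp this).symm
    obtain ⟨a, b, hab⟩ := h1
    refine (Ideal.ne_top_iff_one v).mp hvmax.ne_top ?_
    have h2 : ((a : 𝓞 K) * q + b * Ideal.absNorm v) = 1 := by
      exact_mod_cast congrArg (Int.cast : ℤ → 𝓞 K) hab
    rw [← h2]
    exact add_mem (v.mul_mem_left _ h) (v.mul_mem_left _ (Ideal.absNorm_mem v))
  obtain ⟨P, hP, hPv, hcard⟩ := exists_liesOver_card_quotient_eq (S := 𝓞 ↥(K ⊔ E))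
    Gal(ℚ⟮zetaC n⟯/K) (zetaInt_pow hqM) hv hqv (fun σ hσ x ↦ by
      rw [natCard_quotient_eq_absNorm] at hσ
      have hid : (ℚ⟮zetaC n⟯).val.comp ((σ.restrictScalars ℚ : ℚ⟮zetaC n⟯ →ₐ[ℚ] ℚ⟮zetaC n⟯).comp
          (inclusion hL)) = (K ⊔ E).val := by
        have hsup : K ⊔ E = adjoin ℚ ((K : Set ℂ) ∪ E) := by simp [adjoin_union]
        refine algHom_ext_of_eq_adjoin ℚ hsup fun y hy ↦ ?_
        rcases hy with hy | hy
        · exact congrArg Subtype.val (σ.commutes ⟨y, hy⟩)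
        · exact apply_eq_of_finrank_eq hE hfin u ((ℚ⟮zetaC n⟯).val.comp
            ((σ.restrictScalars ℚ : ℚ⟮zetaC n⟯ →ₐ[ℚ] ℚ⟮zetaC n⟯).comp (inclusion hqM))) hu
            (congrArg (fun z : 𝓞 ℚ⟮zetaC n⟯ ↦ ((z : ℚ⟮zetaC n⟯) : ℂ)) hσ) ⟨y, hE hy⟩ hy
      exact RingOfIntegers.ext (Subtype.ext (DFunLike.congr_fun hid _)))
  refine ⟨P, hP, hPv, ?_⟩
  rw [← natCard_quotient_eq_absNorm, ← natCard_quotient_eq_absNorm, hcard]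

end Splitting

section PRank

variable {G : Type*} [CommGroup G] {p : ℕ} (hp : p.Prime)

lemma mem_pPart_iff {g : G} : g ∈ pPart G p hp ↔ ∃ k, g ^ p ^ k = 1 :=
  Iff.rfl

lemma pRank_eq_factorization [Finite G] :
    pRank G p hp = (Nat.card {g : G // g ^ p = 1}).factorization p := by
  set f : ↥(pPart G p hp) →* ↥(pPart G p hp) := powMonoidHom p with hf
  have h1 := f.ker.card_mul_index
  rw [Subgroup.index_ker, ← f.range.index_mul_card] at h1
  have h2 : f.range.index = Nat.card f.ker := (Nat.eq_of_mul_eq_mul_right Nat.card_pos h1).symm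
  have h3 : Nat.card f.ker = Nat.card {g : G // g ^ p = 1} := Nat.card_congr
    { toFun g := ⟨g.1.1, congrArg Subtype.val g.2⟩
      invFun g := ⟨⟨g.1, (mem_pPart_iff hp).mpr ⟨1, by rw [pow_one, g.2]⟩⟩, Subtype.ext g.2⟩
      left_inv _ := rfl
      right_inv _ := rfl }
  rw [pRank, ← hf, ← h3, ← h2]
  rfl

lemma card_eq_pCard_mul [Finite G] : ∃ k, ¬ p ∣ k ∧ Nat.card G = pCard G p hp * k := by
  have : Fact p.Prime := ⟨hp⟩
  refine ⟨(pPart G p hp).index, fun h ↦ ?_, (Subgroup.card_mul_index _).symm⟩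
  obtain ⟨x, hx⟩ := exists_prime_orderOf_dvd_card' (G := G ⧸ pPart G p hp) p h
  obtain ⟨g, rfl⟩ := QuotientGroup.mk_surjective x
  have h1 := (orderOf_dvd_iff_pow_eq_one (n := p)).mp hx.dvd
  rw [← QuotientGroup.mk_pow, QuotientGroup.eq_one_iff, mem_pPart_iff] at h1
  obtain ⟨k, hk⟩ := h1
  have h2 : g ∈ pPart G p hp := (mem_pPart_iff hp).mpr ⟨k + 1, by rw [pow_succ', pow_mul, hk]⟩
  rw [(QuotientGroup.eq_one_iff g).mpr h2, orderOf_one] at hx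
  exact hp.one_lt.ne hx

lemma exists_mem_pPart_map_eq {D C : Type*} [CommGroup D] [CommGroup C] [Finite D]
    (N : D →* C) (hN : Function.Surjective N) {c : C} (hc : c ∈ pPart C p hp) :
    ∃ d ∈ pPart D p hp, N d = c := by
  have : Fact p.Prime := ⟨hp⟩
  obtain ⟨k, hk, hDk⟩ := card_eq_pCard_mul hp (G := D)
  obtain ⟨a, ha⟩ : ∃ a, pCard D p hp = p ^ a :=
    (CommGroup.primaryComponent.isPGroup (p := p) (G := D)).exists_card_eq
  obtain ⟨j, hj⟩ := (mem_pPart_iff hp).mp hc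
  have hcop : Nat.Coprime k (orderOf c) :=
    ((((Nat.Prime.coprime_iff_not_dvd hp).mpr hk).symm).pow_right j).coprime_dvd_right
      (orderOf_dvd_of_pow_eq_one hj)
  obtain ⟨i, hi⟩ := exists_pow_eq_self_of_coprime hcop
  obtain ⟨d, hd⟩ := hN (c ^ i)
  refine ⟨d ^ k, (mem_pPart_iff hp).mpr ⟨a, ?_⟩, ?_⟩
  · rw [← pow_mul, mul_comm, ← ha, ← hDk, pow_card_eq_one']
  · rw [map_pow, hd, ← pow_mul, mul_comm, pow_mul, hi]

/-- A surjection between finite abelian groups of equal `p`-class number is injective on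
`p`-primary components. -/
lemma eq_one_of_map_eq_one {D C : Type*} [CommGroup D] [CommGroup C] [Finite D]
    (N : D →* C) (hN : Function.Surjective N) (hcard : pCard D p hp = pCard C p hp) {d : D}
    (hd : d ∈ pPart D p hp) (h : N d = 1) : d = 1 := by
  have hfin : Finite C := Finite.of_surjective N hN
  let M : ↥(pPart D p hp) →* ↥(pPart C p hp) :=
    (N.comp (pPart D p hp).subtype).codRestrict _ fun x ↦ by
      obtain ⟨j, hj⟩ := (mem_pPart_iff hp).mp x.2
      exact (mem_pPart_iff hp).mpr ⟨j, by simp [← map_pow, hj]⟩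
  have hM : Function.Surjective M := fun ⟨c, hc⟩ ↦ by
    obtain ⟨d, hd, hdc⟩ := exists_mem_pPart_map_eq hp N hN hc
    exact ⟨⟨d, hd⟩, Subtype.ext hdc⟩
  have hinj : Function.Injective M := ((Nat.bijective_iff_surjective_and_card M).mpr ⟨hM, hcard⟩).1
  have := (injective_iff_map_eq_one M).mp hinj ⟨d, hd⟩ (Subtype.ext h)
  exact congrArg Subtype.val this

lemma pRank_ker_eq_and_pRank_eq {D C : Type*} [CommGroup D] [CommGroup C] [Finite D]
    (N : D →* C) (hN : Function.Surjective N) (hcard : pCard D p hp = pCard C p hp)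
    (t : C →* D) (ht : ∀ c, N (t c) = c ^ p) :
    pRank t.ker p hp = pRank C p hp ∧ pRank D p hp = pRank C p hp := by
  have hfin : Finite C := Finite.of_surjective N hN
  have hone : ∀ d : D, ∀ k, d ^ p ^ k = 1 → N d = 1 → d = 1 := fun d k hd ↦
    eq_one_of_map_eq_one hp N hN hcard ((mem_pPart_iff hp).mpr ⟨k, hd⟩)
  have htors : ∀ c : C, c ^ p = 1 → t c = 1 := fun c hc ↦
    hone _ 1 (by rw [pow_one, ← map_pow, hc, map_one]) (by rw [ht, hc])
  rw [pRank_eq_factorization, pRank_eq_factorization, pRank_eq_factorization]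
  refine ⟨?_, ?_⟩
  · congr 2
    let e : {g : t.ker // g ^ p = 1} ≃ {c : C // c ^ p = 1} :=
      { toFun g := ⟨g.1.1, congrArg Subtype.val g.2⟩
        invFun g := ⟨⟨g.1, htors g.1 g.2⟩, Subtype.ext g.2⟩
        left_inv _ := rfl
        right_inv _ := rfl }
    exact Nat.card_congr e
  · congr 2
    let f : {d : D // d ^ p = 1} → {c : C // c ^ p = 1} := fun d ↦
      ⟨N d.1, by rw [← map_pow, d.2, map_one]⟩
    refine Nat.card_congr (Equiv.ofBijective f ⟨fun d e h ↦ Subtype.ext ?_, fun ⟨c, hc⟩ ↦ ?_⟩)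
    · refine div_eq_one.mp (hone _ 1 (by rw [pow_one, div_pow, d.2, e.2, div_one]) ?_)
      rw [map_div, div_eq_one]
      exact congrArg Subtype.val h
    · obtain ⟨d, hd, rfl⟩ := exists_mem_pPart_map_eq hp N hN
        ((mem_pPart_iff hp).mpr ⟨1, by rw [pow_one, hc]⟩)
      obtain ⟨k, hk⟩ := (mem_pPart_iff hp).mp hd
      exact ⟨⟨d, hone _ k (by rw [← pow_mul, mul_comm, pow_mul, hk, one_pow])
        (by rw [map_pow, hc])⟩, rfl⟩

end PRank

section ClassGroupNorm

variable {K L : Type*} [Field K] [NumberField K] [Field L] [NumberField L] [Algebra K L]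

/-- The relative norm of a nonzero ideal, as a nonzero ideal. -/
def relNormNonZero (K : Type*) {L : Type*} [Field K] [NumberField K] [Field L] [NumberField L]
    [Algebra K L] (I : (Ideal (𝓞 L))⁰) : (Ideal (𝓞 K))⁰ :=
  ⟨Ideal.relNorm (𝓞 K) (I : Ideal (𝓞 L)), mem_nonZeroDivisors_iff_ne_zero.mpr fun h ↦
    nonZeroDivisors.coe_ne_zero I (Ideal.relNorm_eq_bot_iff.mp h)⟩

lemma mk0_relNormNonZero_eq_of_mk0_eq {I J : (Ideal (𝓞 L))⁰}
    (h : ClassGroup.mk0 I = ClassGroup.mk0 J) :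
    ClassGroup.mk0 (relNormNonZero K I) = ClassGroup.mk0 (relNormNonZero K J) := by
  obtain ⟨x, y, hx, hy, hxy⟩ := ClassGroup.mk0_eq_mk0_iff.mp h
  refine ClassGroup.mk0_eq_mk0_iff.mpr ⟨Algebra.intNorm (𝓞 K) (𝓞 L) x,
    Algebra.intNorm (𝓞 K) (𝓞 L) y, Algebra.intNorm_ne_zero.mpr hx,
    Algebra.intNorm_ne_zero.mpr hy, ?_⟩
  have := congrArg (Ideal.relNorm (𝓞 K)) hxy
  simp only [map_mul, Ideal.relNorm_singleton] at this
  exact this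

/-- The norm map on class groups. -/
def classGroupNorm (K L : Type*) [Field K] [NumberField K] [Field L] [NumberField L]
    [Algebra K L] : ClassGroup (𝓞 L) →* ClassGroup (𝓞 K) :=
  MonoidHom.mk' (fun c ↦ ClassGroup.mk0 (relNormNonZero K
    (Function.surjInv ClassGroup.mk0_surjective c))) fun c d ↦ by
      rw [← map_mul]
      have h (c : ClassGroup (𝓞 L)) := Function.surjInv_eq ClassGroup.mk0_surjective c
      refine (mk0_relNormNonZero_eq_of_mk0_eq (J := Function.surjInv ClassGroup.mk0_surjective c *
        Function.surjInv ClassGroup.mk0_surjective d) (by rw [map_mul, h, h, h])).trans ?_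
      congr 1
      exact Subtype.ext (map_mul (Ideal.relNorm (𝓞 K)) _ _)

lemma classGroupNorm_mk0 (I : (Ideal (𝓞 L))⁰) :
    classGroupNorm K L (ClassGroup.mk0 I) = ClassGroup.mk0 (relNormNonZero K I) :=
  mk0_relNormNonZero_eq_of_mk0_eq (Function.surjInv_eq ClassGroup.mk0_surjective _)

lemma classGroupNorm_mk0_of_eq_map {I : (Ideal (𝓞 K))⁰} {J : (Ideal (𝓞 L))⁰}
    (h : (J : Ideal (𝓞 L)) = Ideal.map (algebraMap (𝓞 K) (𝓞 L)) I) :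
    classGroupNorm K L (ClassGroup.mk0 J) = ClassGroup.mk0 I ^ finrank K L := by
  rw [classGroupNorm_mk0, ← map_pow]
  congr 1
  refine Subtype.ext ?_
  change Ideal.relNorm (𝓞 K) (J : Ideal (𝓞 L)) = (I : Ideal (𝓞 K)) ^ finrank K L
  rw [h, Ideal.relNorm_algebraMap, IsFractionRing.finrank_eq (𝓞 K) K (𝓞 L) L]

lemma mk0_mem_range_classGroupNorm {v : (Ideal (𝓞 K))⁰} [hv : (v : Ideal (𝓞 K)).IsPrime]
    {P : Ideal (𝓞 L)} [P.IsPrime] [P.LiesOver (v : Ideal (𝓞 K))]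
    (h : Ideal.absNorm P = Ideal.absNorm (v : Ideal (𝓞 K))) :
    ClassGroup.mk0 v ∈ (classGroupNorm K L).range := by
  have hv0 : (v : Ideal (𝓞 K)) ≠ ⊥ := nonZeroDivisors.coe_ne_zero v
  have hP0 : P ≠ ⊥ := Ideal.ne_bot_of_liesOver_of_ne_bot hv0 P
  obtain ⟨s, hs⟩ := Ideal.exists_relNorm_eq_pow_of_isPrime P (v : Ideal (𝓞 K))
  have h1 := Ideal.absNorm_relNorm (R := 𝓞 K) (S := 𝓞 L) P
  rw [hs, map_pow, h] at h1
  have hlt : 1 < Ideal.absNorm (v : Ideal (𝓞 K)) := by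
    have h0 : Ideal.absNorm (v : Ideal (𝓞 K)) ≠ 0 := Ideal.absNorm_ne_zero_of_nonZeroDivisors v
    have h1 : Ideal.absNorm (v : Ideal (𝓞 K)) ≠ 1 := mt Ideal.absNorm_eq_one_iff.mp hv.ne_top
    omega
  have hs1 : s = 1 := Nat.pow_right_injective hlt (h1.trans (pow_one _).symm)
  refine ⟨ClassGroup.mk0 ⟨P, mem_nonZeroDivisors_iff_ne_zero.mpr hP0⟩, ?_⟩
  rw [classGroupNorm_mk0]
  congr 1
  exact Subtype.ext (by rw [← pow_one (v : Ideal (𝓞 K)), ← hs1]; exact hs)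

end ClassGroupNorm

section RealQuadratic

lemma conj_eq_of_mem_realCyclo {n : ℕ} {x : ℂ} (hx : x ∈ realCyclo n) :
    starRingEnd ℂ x = x := by
  have hz : starRingEnd ℂ (zetaC n) = (zetaC n)⁻¹ := by
    rw [zetaC, ← Complex.exp_conj, ← Complex.exp_neg]
    congr 1
    simp only [map_div₀, map_mul, Complex.conj_ofNat, Complex.conj_ofReal, Complex.conj_I,
      map_natCast]
    ring
  have h : ((Complex.conjAe.toAlgHom.restrictScalars ℚ).comp (realCyclo n).val) =
      (realCyclo n).val := by
    refine adjoin_algHom_ext ℚ fun y hy ↦ ?_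
    rw [Set.mem_singleton_iff] at hy
    subst hy
    change starRingEnd ℂ (zetaC n + (zetaC n)⁻¹) = zetaC n + (zetaC n)⁻¹
    rw [map_add, map_inv₀, hz, inv_inv, add_comm]
  exact DFunLike.congr_fun h ⟨x, hx⟩

lemma isTotallyReal_of_le_realCyclo {n : ℕ} {K : IntermediateField ℚ ℂ} [FiniteDimensional ℚ K]
    (hK : K ≤ realCyclo n) (hfin : finrank ℚ K = 2) : IsTotallyReal K := by
  rw [← nrComplexPlaces_eq_zero_iff]
  have h1 : 0 < InfinitePlace.nrRealPlaces K := by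
    have hreal : ComplexEmbedding.IsReal (algebraMap K ℂ) :=
      RingHom.ext fun x ↦ conj_eq_of_mem_realCyclo (hK x.2)
    classical
    exact Fintype.card_pos_iff.mpr ⟨⟨InfinitePlace.mk _, ⟨_, hreal, rfl⟩⟩⟩
  have h2 := InfinitePlace.card_add_two_mul_card_eq_rank K
  rw [hfin] at h2
  omega

lemma exists_infinitePlace_pair {K : Type*} [Field K] [NumberField K] [IsTotallyReal K]
    (hfin : finrank ℚ K = 2) :
    ∃ w₁ w₂ : InfinitePlace K, (∀ w, w = w₁ ∨ w = w₂) ∧ w₁ ≠ w₂ := by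
  classical
  have h2 := InfinitePlace.card_add_two_mul_card_eq_rank K
  have h3 := InfinitePlace.card_eq_nrRealPlaces_add_nrComplexPlaces K
  have h4 : InfinitePlace.nrComplexPlaces K = 0 := nrComplexPlaces_eq_zero_iff.mpr inferInstance
  have h5 : (Finset.univ : Finset (InfinitePlace K)).card = 2 := by
    rw [Finset.card_univ]
    omega
  obtain ⟨w₁, w₂, hne, h⟩ := Finset.card_eq_two.mp h5
  refine ⟨w₁, w₂, fun w ↦ ?_, hne⟩
  simpa [h] using Finset.mem_univ w

end RealQuadratic

lemma exists_eq_pow_of_apply_eq_one {q ℓ : ℕ} [Fact q.Prime] {η : DirichletCharacter ℂ q}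
    (hη : orderOf η = ℓ) {u : (ZMod q)ˣ} (hu : η u = 1) : ∃ w : (ZMod q)ˣ, u = w ^ ℓ := by
  obtain ⟨g, hg⟩ := IsCyclic.exists_monoid_generator (α := (ZMod q)ˣ)
  obtain ⟨k, rfl⟩ := Submonoid.mem_powers_iff _ _ |>.mp (hg u)
  have h1 : η ^ k = 1 := by
    ext w
    obtain ⟨i, rfl⟩ := Submonoid.mem_powers_iff _ _ |>.mp (hg w)
    rw [MulChar.one_apply_coe, MulChar.pow_apply_coe, Units.val_pow_eq_pow_val, map_pow,
      pow_right_comm, ← map_pow, ← Units.val_pow_eq_pow_val, hu, one_pow]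
  obtain ⟨j, rfl⟩ := hη ▸ orderOf_dvd_of_pow_eq_one h1
  exact ⟨g ^ j, by rw [← pow_mul, mul_comm]⟩

section NormSurjective

open IsDedekindDomain

lemma classGroupNorm_surjective {n ℓ q : ℕ} [NeZero n] (hℓ : ℓ.Prime) (hℓodd : Odd ℓ)
    (hq : q.Prime) (hqn : q ∣ n) (hqℓ : q ≡ 1 [MOD ℓ])
    {K E : IntermediateField ℚ ℂ} [FiniteDimensional ℚ K] [FiniteDimensional ℚ E]
    (hK : K ≤ realCyclo n) (hKfin : finrank ℚ K = 2) (hE : E ≤ ℚ⟮zetaC q⟯)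
    (hEfin : finrank ℚ E = ℓ) [Algebra K ↥(K ⊔ E)] [IsScalarTower K ↥(K ⊔ E) ℂ]
    (hpow : ∀ c : ClassGroup (𝓞 K), c ^ ℓ ∈ (classGroupNorm K ↥(K ⊔ E)).range) :
    Function.Surjective (classGroupNorm K ↥(K ⊔ E)) := by
  rw [← MonoidHom.range_eq_top]
  by_contra hne
  set A := (classGroupNorm K ↥(K ⊔ E)).range
  have hKn := hK.trans (realCyclo_le n)
  have : Fact q.Prime := ⟨hq⟩
  obtain ⟨c, hc⟩ : ∃ c, c ∉ A := by
    by_contra! h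
    exact hne (eq_top_iff.mpr fun c _ ↦ h c)
  obtain ⟨φ, hφ⟩ := CommGroup.exists_apply_ne_one_of_hasEnoughRootsOfUnity (ClassGroup (𝓞 K) ⧸ A) ℂ
    (a := QuotientGroup.mk c) (mt (QuotientGroup.eq_one_iff c).mp hc)
  set χ : ClassGroup (𝓞 K) →* ℂˣ := φ.comp (QuotientGroup.mk' A)
  have hχA : ∀ a ∈ A, χ a = 1 := fun a ha ↦ by
    change φ (QuotientGroup.mk a) = 1
    rw [(QuotientGroup.eq_one_iff a).mpr ha, map_one]
  have hχ : χ ≠ 1 := fun h ↦ hφ (DFunLike.congr_fun h c)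
  have hχℓ : χ ^ ℓ = 1 := by
    ext a
    rw [MonoidHom.pow_apply, ← map_pow, hχA _ (hpow a), MonoidHom.one_apply]
  obtain ⟨η, hη⟩ : ∃ η : DirichletCharacter ℂ q, orderOf η = ℓ :=
    MulChar.exists_mulChar_orderOf (ZMod q)
      (by rw [ZMod.card]; exact (Nat.modEq_iff_dvd' hq.one_le).mp hqℓ.symm)
      (Complex.isPrimitiveRoot_exp ℓ hℓ.ne_zero)
  have := isTotallyReal_of_le_realCyclo hK hKfin
  obtain ⟨w₁, w₂, hw, hw12⟩ := exists_infinitePlace_pair hKfin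
  obtain ⟨C, hC⟩ := exists_sum_inv_absNorm_le hw hw12 hKfin hq hℓ hℓodd hη hχ hχℓ fun v hv ↦ by
    have hunit : IsUnit ((Ideal.absNorm v.asIdeal : ℕ) : ZMod q) := by
      by_contra h
      rw [η.map_nonunit h] at hv
      exact zero_ne_one hv
    obtain ⟨u, hu⟩ := hunit
    obtain ⟨w, rfl⟩ := exists_eq_pow_of_apply_eq_one hη (hu ▸ hv)
    obtain ⟨P, hP, hPv, hcard⟩ := exists_liesOver_absNorm_eq hq hqn hKn hE hEfin v.ne_bot w
      (by rw [← hu, Units.val_pow_eq_pow_val])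
    have : (primeIdeal v : Ideal (𝓞 K)).IsPrime := v.isPrime
    have : P.LiesOver (primeIdeal v : Ideal (𝓞 K)) := hPv
    exact hχA _ (mk0_mem_range_classGroupNorm hcard)
  refine not_summable_inv_prime_eq_one_mod n (summable_of_sum_le (c := C) (fun p ↦ ?_) fun s ↦ ?_)
  · split_ifs <;> positivity
  have hex : ∀ p : {p : ℕ // p.Prime ∧ (p : ZMod n) = 1}, ∃ v : HeightOneSpectrum (𝓞 K),
      Ideal.absNorm v.asIdeal = p.1 := fun p ↦ by
    obtain ⟨P, hP, hP0, hcard⟩ := exists_absNorm_eq_of_eq_one_mod p.2.1 p.2.2 hKn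
    exact ⟨⟨P, hP, hP0⟩, hcard⟩
  choose f hf using hex
  have hinj : Function.Injective f := fun p p' h ↦ Subtype.ext (by rw [← hf, ← hf, h])
  classical
  rw [← Finset.sum_filter, ← Finset.sum_subtype_eq_sum_filter]
  refine le_trans (le_of_eq ?_) (hC ((s.subtype _).map ⟨f, hinj⟩) fun v hv ↦ ?_)
  · rw [Finset.sum_map]
    exact Finset.sum_congr rfl fun p _ ↦ by rw [Function.Embedding.coeFn_mk, hf]
  · obtain ⟨p, -, rfl⟩ := Finset.mem_map.mp hv
    have h1 : ((p.1 : ℕ) : ZMod q) = 1 := by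
      rw [← map_natCast (ZMod.castHom hqn (ZMod q)), p.2.2, map_one]
    rw [Function.Embedding.coeFn_mk, hf, h1, map_one]

end NormSurjective

/-- start of Case II of the proof of Theorem 1.2. -/
theorem statement_16
    (n ℓ q m : ℕ) (hn : 0 < n) (hℓ : ℓ.Prime) (hℓodd : Odd ℓ)
    (hq : q.Prime) (hqn : q ∣ n) (hqℓ : q ≡ 1 [MOD ℓ]) (hm : 1 ≤ m)
    (K₂ Kl : IntermediateField ℚ ℂ) [FiniteDimensional ℚ K₂] [FiniteDimensional ℚ Kl]
    (hK₂H : K₂ ≤ realCyclo n) (hK₂deg : Module.finrank ℚ K₂ = 2)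
    (hKl : Kl ≤ realCyclo q) (hKldeg : Module.finrank ℚ Kl = ℓ)
    (hH : pCard (ClassGroup (𝓞 (realCyclo n))) ℓ hℓ = ℓ ^ m)
    (hK₂cl : pCard (ClassGroup (𝓞 K₂)) ℓ hℓ = ℓ ^ (m - 1))
    (hK₂lcl : pCard (ClassGroup (𝓞 ↥(K₂ ⊔ Kl))) ℓ hℓ = ℓ ^ (m - 1))
    (t : ClassGroup (𝓞 K₂) →* ClassGroup (𝓞 ↥(K₂ ⊔ Kl)))
    (ht : IsClassGroupExtHom (le_sup_left : K₂ ≤ K₂ ⊔ Kl) t) :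
    pRank ↥t.ker ℓ hℓ = pRank (ClassGroup (𝓞 K₂)) ℓ hℓ ∧
      pRank (ClassGroup (𝓞 ↥(K₂ ⊔ Kl))) ℓ hℓ = pRank (ClassGroup (𝓞 K₂)) ℓ hℓ := by
  have : NeZero n := ⟨hn.ne'⟩
  let _ : Algebra K₂ ↥(K₂ ⊔ Kl) := (inclusion le_sup_left).toAlgebra
  have : IsScalarTower K₂ ↥(K₂ ⊔ Kl) ℂ := IsScalarTower.of_algebraMap_eq fun _ ↦ rfl
  have : IsScalarTower ℚ K₂ ↥(K₂ ⊔ Kl) := IsScalarTower.of_algebraMap_eq fun x ↦ rfl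
  have hdeg : finrank K₂ ↥(K₂ ⊔ Kl) = ℓ := by
    have h1 := (LinearDisjoint.of_finrank_coprime (F := ℚ) (A := K₂) (L := Kl)
      (by rw [hK₂deg, hKldeg]; exact hℓodd.coprime_two_left)).finrank_sup
    rw [hK₂deg, hKldeg, ← finrank_mul_finrank ℚ K₂ ↥(K₂ ⊔ Kl), hK₂deg] at h1
    exact Nat.eq_of_mul_eq_mul_left two_pos h1
  have hNt : ∀ c, classGroupNorm K₂ ↥(K₂ ⊔ Kl) (t c) = c ^ ℓ := fun c ↦ by
    obtain ⟨I, rfl⟩ := ClassGroup.mk0_surjective c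
    have hI : Ideal.map (algebraMap (𝓞 K₂) (𝓞 ↥(K₂ ⊔ Kl))) I ≠ ⊥ :=
      mt (Ideal.map_eq_bot_iff_of_injective (FaithfulSMul.algebraMap_injective _ _)).mp
        (nonZeroDivisors.coe_ne_zero I)
    rw [ht I ⟨_, mem_nonZeroDivisors_iff_ne_zero.mpr hI⟩ rfl, classGroupNorm_mk0_of_eq_map rfl,
      hdeg]
  exact pRank_ker_eq_and_pRank_eq hℓ (classGroupNorm K₂ ↥(K₂ ⊔ Kl))
    (classGroupNorm_surjective hℓ hℓodd hq hqn hqℓ hK₂H hK₂deg (hKl.trans (realCyclo_le q)) hKldeg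
      fun c ↦ ⟨t c, hNt c⟩) (hK₂lcl.trans hK₂cl.symm) t hNt

end PaperStmt
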